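/- Let D be a compact subset of the set of parameter tuples (A, B, C) ∈ ℝ³ with A² < 2. Then there exists a neighborhood V of the origin in ℝ² such that, for every (A,B,C) ∈ D, the system x' = −y + Ax² + Bxy + Cy², y' = x³ + xy² + y³ has at most 3 limit cycles contained in V. -/

import Mathlib

open Set Metric

/-- A solution of system (4.2): `x' = -y + Ax² + Bxy + Cy²`, `y' = x³ + xy² + y³`. -/
def IsSol42 (A B C : ℝ) (γ : ℝ → ℝ × ℝ) : Prop :=
  ∀ t : ℝ,
    HasDerivAt (fun s => (γ s).1)
      (-(γ t).2 + A * (γ t).1 ^ 2 + B * (γ t).1 * (γ t).2 + C * (γ t).2 ^ 2) t ∧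
    HasDerivAt (fun s => (γ s).2)
      ((γ t).1 ^ 3 + (γ t).1 * (γ t).2 ^ 2 + (γ t).2 ^ 3) t

/-- A periodic orbit of (4.2): the image of a nonconstant periodic solution. -/
def IsPeriodicOrbit42 (A B C : ℝ) (Γ : Set (ℝ × ℝ)) : Prop :=
  ∃ (γ : ℝ → ℝ × ℝ) (T : ℝ), 0 < T ∧ IsSol42 A B C γ ∧
    Function.Periodic γ T ∧ (∃ t, γ t ≠ γ 0) ∧ Γ = Set.range γ

/-- A limit cycle of (4.2): an isolated periodic orbit. -/
def IsLimitCycle42 (A B C : ℝ) (Γ : Set (ℝ × ℝ)) : Prop :=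
  IsPeriodicOrbit42 A B C Γ ∧
  ∃ U : Set (ℝ × ℝ), IsOpen U ∧ Γ ⊆ U ∧
    ∀ Γ' : Set (ℝ × ℝ), IsPeriodicOrbit42 A B C Γ' → Γ' ⊆ U → Γ' = Γ

open Filter Asymptotics Topology

/-- Rolle's theorem, counting zeros: a function has at most one more zero than its derivative. -/
theorem card_zeros_le_of_card_deriv_zeros_le {f f' : ℝ → ℝ} {a b : ℝ} {k : ℕ}
    (hf : ∀ x ∈ Ioo a b, HasDerivAt f (f' x) x)
    (hk : ∀ Z : Finset ℝ, (∀ z ∈ Z, z ∈ Ioo a b ∧ f' z = 0) → Z.card ≤ k)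
    (Z : Finset ℝ) (hZ : ∀ z ∈ Z, z ∈ Ioo a b ∧ f z = 0) : Z.card ≤ k + 1 := by
  have hfin : {z | z ∈ Ioo a b ∧ f' z = 0}.Finite := by
    by_contra hinf
    obtain ⟨W, hW, hc⟩ := Set.Infinite.exists_subset_card_eq hinf (k + 1)
    have := hk W fun z hz => hW hz
    omega
  have h1 : Z.card ≤ (hfin.toFinset \ Z).card + 1 := by
    refine Finset.card_le_sdiff_of_interleaved fun x hx y hy hxy _ => ?_
    have hsub : Icc x y ⊆ Ioo a b := fun z hz =>
      ⟨(hZ x hx).1.1.trans_le hz.1, hz.2.trans_lt (hZ y hy).1.2⟩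
    obtain ⟨c, hc, hc0⟩ := exists_hasDerivAt_eq_zero hxy
      (fun z hz => (hf z (hsub hz)).continuousAt.continuousWithinAt)
      ((hZ x hx).2.trans (hZ y hy).2.symm)
      (fun z hz => hf z (hsub (Ioo_subset_Icc_self hz)))
    exact ⟨c, by simpa using ⟨hsub (Ioo_subset_Icc_self hc), hc0⟩, hc.1, hc.2⟩
  have h2 : (hfin.toFinset \ Z).card ≤ k := hk _ fun z hz => by
    simpa using (Finset.mem_sdiff.1 hz).1
  omega

theorem isBigO_pow_succ_of_deriv {f f' : ℝ → ℝ} {k : ℕ} (h0 : f 0 = 0)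
    (hf : ∀ᶠ x in 𝓝 0, HasDerivAt f (f' x) x)
    (hf' : f' =O[𝓝 0] fun x => x ^ k) : f =O[𝓝 0] fun x => x ^ (k + 1) := by
  obtain ⟨c, hc⟩ := hf'.bound
  obtain ⟨δ, hδ, hball⟩ := Metric.eventually_nhds_iff_ball.1 (hf.and hc)
  refine IsBigO.of_bound c (Metric.eventually_nhds_iff_ball.2 ⟨δ, hδ, fun x hx => ?_⟩)
  have hsub : closedBall (0 : ℝ) |x| ⊆ ball 0 δ := closedBall_subset_ball (by simpa using hx)
  have hc0 : 0 ≤ c * |x| ^ k := by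
    have := (norm_nonneg _).trans (hball x hx).2
    simpa using this
  have key := (convex_closedBall (0 : ℝ) |x|).norm_image_sub_le_of_norm_hasDerivWithin_le
    (f := f) (f' := f') (C := c * |x| ^ k) (x := 0) (y := x)
    (fun z hz => (hball z (hsub hz)).1.hasDerivWithinAt)
    (fun z hz => by
      refine (hball z (hsub hz)).2.trans ?_
      rw [norm_pow, Real.norm_eq_abs]
      rcases le_or_gt 0 c with hc | hc
      · exact mul_le_mul_of_nonneg_left
          (pow_le_pow_left₀ (abs_nonneg _) (by simpa using hz) _) hc
      · have h1 : 0 ≤ c * |z| ^ k := by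
          have := (norm_nonneg _).trans (hball z (hsub hz)).2
          simpa using this
        have h2 : |z| ^ k = 0 := by
          have := pow_nonneg (abs_nonneg z) k
          nlinarith
        rw [h2]; simpa using hc0)
    (by simp) (by simp)
  simpa [h0, pow_succ, mul_assoc] using key

/-- If `f (·, p₀)` does not vanish to order `k + 1` at `0`, then `f (·, p)` has at most `k` zeros
in a uniform neighbourhood of `0`, for all `p` near `p₀`. -/
theorem exists_card_zeros_le {E : Type*} [NormedAddCommGroup E] [NormedSpace ℝ E] (p₀ : E) (k : ℕ) :
    ∀ f : ℝ × E → ℝ, ContDiffAt ℝ (k + 1 : ℕ) f (0, p₀) →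
      ¬ ((fun ρ => f (ρ, p₀)) =O[𝓝 0] fun ρ : ℝ => ρ ^ (k + 1)) →
      ∃ δ > 0, ∀ᶠ p in 𝓝 p₀, ∀ Z : Finset ℝ,
        (∀ z ∈ Z, z ∈ Ioo (-δ) δ ∧ f (z, p) = 0) → Z.card ≤ k := by
  have nonzero : ∀ f : ℝ × E → ℝ, ContinuousAt f (0, p₀) → f (0, p₀) ≠ 0 →
      ∃ δ > 0, ∀ᶠ p in 𝓝 p₀, ∀ Z : Finset ℝ,
        (∀ z ∈ Z, z ∈ Ioo (-δ) δ ∧ f (z, p) = 0) → Z.card = 0 := by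
    intro f hf h0
    have := hf.eventually_ne h0
    rw [nhds_prod_eq, eventually_prod_iff] at this
    obtain ⟨pa, ha, pb, hb, hab⟩ := this
    obtain ⟨δ, hδ, hball⟩ := Metric.eventually_nhds_iff_ball.1 ha
    refine ⟨δ, hδ, hb.mono fun p hp Z hZ => ?_⟩
    rw [Finset.card_eq_zero, Finset.eq_empty_iff_forall_notMem]
    intro z hz
    refine hab (hball z ?_) hp (hZ z hz).2
    rw [Real.ball_eq_Ioo]; simpa using (hZ z hz).1
  induction k with
  | zero =>
    intro f hf hO
    have h0 : f (0, p₀) ≠ 0 := by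
      intro h0
      apply hO
      have hd : DifferentiableAt ℝ (fun ρ : ℝ => f (ρ, p₀)) 0 := by
        have h1 : DifferentiableAt ℝ f (0, p₀) := hf.differentiableAt (by norm_num)
        exact h1.comp (0 : ℝ) (by fun_prop : DifferentiableAt ℝ (fun ρ : ℝ => (ρ, p₀)) 0)
      simpa [h0] using hd.isBigO_sub
    obtain ⟨δ, hδ, h⟩ := nonzero f hf.continuousAt h0
    exact ⟨δ, hδ, h.mono fun p hp Z hZ => (hp Z hZ).le⟩
  | succ k ih =>
    intro f hf hO
    by_cases h0 : f (0, p₀) = 0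
    swap
    · obtain ⟨δ, hδ, h⟩ := nonzero f hf.continuousAt h0
      exact ⟨δ, hδ, h.mono fun p hp Z hZ => (hp Z hZ).le.trans (Nat.zero_le _)⟩
    set g : ℝ × E → ℝ := fun q => fderiv ℝ f q (1, 0) with hg
    have hgc : ContDiffAt ℝ (k + 1 : ℕ) g (0, p₀) := by
      have : ContDiffAt ℝ (k + 1 : ℕ) (fderiv ℝ f) (0, p₀) :=
        hf.fderiv_right (by norm_cast)
      exact this.clm_apply contDiffAt_const
    have hder : ∀ᶠ q in 𝓝 ((0 : ℝ), p₀), HasDerivAt (fun ρ => f (ρ, q.2)) (g q) q.1 := by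
      have h1 := hf.eventually (by simp)
      refine h1.mono fun q hq => ?_
      have h2 : HasFDerivAt f (fderiv ℝ f q) (q.1, q.2) :=
        (hq.differentiableAt (by norm_num)).hasFDerivAt
      exact h2.comp_hasDerivAt q.1 ((hasDerivAt_id q.1).prodMk (hasDerivAt_const q.1 q.2))
    have hder0 : ∀ᶠ ρ in 𝓝 (0 : ℝ), HasDerivAt (fun ρ => f (ρ, p₀)) (g (ρ, p₀)) ρ := by
      have : Tendsto (fun ρ : ℝ => (ρ, p₀)) (𝓝 0) (𝓝 (0, p₀)) :=
        Continuous.tendsto (by fun_prop) 0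
      exact this.eventually hder
    obtain ⟨δ, hδ, h⟩ := ih g hgc fun hO' => hO (isBigO_pow_succ_of_deriv h0 hder0 hO')
    rw [nhds_prod_eq, eventually_prod_iff] at hder
    obtain ⟨pa, ha, pb, hb, hab⟩ := hder
    obtain ⟨δ', hδ', hball⟩ := Metric.eventually_nhds_iff_ball.1 ha
    refine ⟨min δ δ', lt_min hδ hδ', (h.and hb).mono fun p hp Z hZ => ?_⟩
    refine card_zeros_le_of_card_deriv_zeros_le (f := fun ρ => f (ρ, p)) (f' := fun ρ => g (ρ, p))
      (a := -min δ δ') (b := min δ δ') (fun x hx => ?_) (fun W hW => hp.1 W fun z hz => ?_) Z hZ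
    · refine hab (hball x ?_) hp.2
      rw [Real.ball_eq_Ioo]
      have := min_le_right δ δ'
      constructor <;> [linarith [hx.1]; linarith [hx.2]]
    · have := min_le_left δ δ'
      have h2 := hW z hz
      exact ⟨⟨by linarith [h2.1.1], by linarith [h2.1.2]⟩, h2.2⟩

section HalfMap

variable {L : ℝ}

/-- The integration operator `f ↦ (t ↦ ∫₀ᵗ f)` on continuous functions on `[0, L]`. -/
noncomputable def integrationCLM (hL : 0 ≤ L) : C(Icc 0 L, ℝ) →L[ℝ] C(Icc 0 L, ℝ) :=
  LinearMap.mkContinuous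
    { toFun := fun f => ⟨fun t => ∫ s in (0 : ℝ)..t, IccExtend hL f s, by
        have : Continuous fun t : ℝ => ∫ s in (0 : ℝ)..t, IccExtend hL f s :=
          intervalIntegral.continuous_primitive
            (fun a b => (f.continuous.Icc_extend' (h := hL)).intervalIntegrable a b) 0
        exact this.comp continuous_subtype_val⟩
      map_add' := fun f g => by
        ext t
        exact intervalIntegral.integral_add
            ((f.continuous.Icc_extend' (h := hL)).intervalIntegrable _ _)
          ((g.continuous.Icc_extend' (h := hL)).intervalIntegrable _ _)
      map_smul' := fun c f => by
        ext t
        exact intervalIntegral.integral_const_mul c (IccExtend hL f) }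
    L fun f => by
      refine (ContinuousMap.norm_le _ (mul_nonneg hL (norm_nonneg f))).2 fun t => ?_
      have := intervalIntegral.norm_integral_le_of_norm_le_const (a := (0 : ℝ)) (b := t) (C := ‖f‖)
        (f := IccExtend hL f) fun s _ => f.norm_coe_le_norm _
      refine this.trans ?_
      rw [sub_zero, abs_of_nonneg t.2.1, mul_comm]
      exact mul_le_mul_of_nonneg_right t.2.2 (norm_nonneg f)

theorem integrationCLM_apply (hL : 0 ≤ L) (f : C(Icc 0 L, ℝ)) (t : Icc 0 L) :
    integrationCLM hL f t = ∫ s in (0 : ℝ)..t, IccExtend hL f s := rfl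

theorem hasDerivAt_integral_IccExtend (hL : 0 ≤ L) (f : C(Icc 0 L, ℝ)) (t : ℝ) :
    HasDerivAt (fun t => ∫ s in (0 : ℝ)..t, IccExtend hL f s) (IccExtend hL f t) t :=
  intervalIntegral.integral_hasDerivAt_right
    ((f.continuous.Icc_extend' (h := hL)).intervalIntegrable _ _)
    ((f.continuous.Icc_extend' (h := hL)).stronglyMeasurableAtFilter _ _)
    (f.continuous.Icc_extend' (h := hL)).continuousAt

/-- Smooth dependence on initial condition and parameter for `u' = u * M p u t` near `u = 0`. -/
theorem exists_smooth_transition_map {P : Type*} [NormedAddCommGroup P] [NormedSpace ℝ P]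
    [CompleteSpace P] (hL : 0 ≤ L) (n : ℕ) (hn : n ≠ 0) (p₀ : P) (M : P → ℝ → ℝ → ℝ)
    (N : P × C(Icc 0 L, ℝ) → C(Icc 0 L, ℝ)) (hN : ContDiffAt ℝ n N (p₀, 0))
    (hNM : ∀ᶠ q in 𝓝 (p₀, (0 : C(Icc 0 L, ℝ))), ∀ t, N q t = M q.1 (q.2 t) t) :
    ∃ (φ : ℝ × P → ℝ) (η : ℝ), 0 < η ∧ ContDiffAt ℝ n φ (0, p₀) ∧
      (∀ᶠ p in 𝓝 p₀, ∀ R : ℝ → ℝ,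
        (∀ t ∈ Icc 0 L, HasDerivAt R (R t * M p (R t) t) t ∧ |R t| < η) → φ (R 0, p) = R L) ∧
      (∀ η' > 0, ∀ᶠ ρ in 𝓝 (0 : ℝ), ∃ R : ℝ → ℝ, R 0 = ρ ∧ φ (ρ, p₀) = R L ∧
        ∀ t ∈ Icc 0 L, HasDerivAt R (R t * M p₀ (R t) t) t ∧ |R t| ≤ η') := by
  set J := integrationCLM hL
  set k := N (p₀, 0) with hk
  set ee : ℝ → ℝ := fun t => Real.exp (∫ s in (0 : ℝ)..t, IccExtend hL k s) with hee
  have hee' : ∀ t, HasDerivAt ee (ee t * IccExtend hL k t) t := fun t =>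
    (hasDerivAt_integral_IccExtend hL k t).exp
  have heec : Continuous ee := continuous_iff_continuousAt.2 fun t => (hee' t).continuousAt
  obtain ⟨e, he⟩ : ∃ e : C(Icc 0 L, ℝ), ∀ t, e t = ee t :=
      ⟨⟨fun t => ee t, by fun_prop⟩, fun t => rfl⟩
  obtain ⟨ei, hei⟩ : ∃ ei : C(Icc 0 L, ℝ), ∀ t, ei t = (ee t)⁻¹ := ⟨⟨fun t => (ee t)⁻¹,
    (heec.comp continuous_subtype_val).inv₀ fun t => (Real.exp_pos _).ne'⟩, fun t => rfl⟩
  set F : (ℝ × P) × C(Icc 0 L, ℝ) → C(Icc 0 L, ℝ) := fun q =>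
    q.2 - q.1.1 • 1 - J (q.2 * (N (q.1.2, e * q.2) - k)) with hF
  have hF0 : F ((0, p₀), 0) = 0 := by simp [hF]
  have hNc : ContDiffAt ℝ n (fun q : (ℝ × P) × C(Icc 0 L, ℝ) => N (q.1.2, e * q.2))
      ((0, p₀), 0) := by
    refine ContDiffAt.comp (g := N) ((0, p₀), (0 : C(Icc 0 L, ℝ))) ?_ ?_
    · simpa using hN
    · fun_prop
  have hFc : ContDiffAt ℝ n F ((0, p₀), 0) := by
    refine (contDiffAt_snd.sub (by fun_prop)).sub (J.contDiff.contDiffAt.comp _ ?_)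
    exact contDiffAt_snd.mul (hNc.sub contDiffAt_const)
  have hn' : ((n : ℕ) : WithTop ℕ∞) ≠ 0 := by exact_mod_cast hn
  have hid : fderiv ℝ F ((0, p₀), 0) ∘L .inr ℝ (ℝ × P) C(Icc 0 L, ℝ)
      = ContinuousLinearMap.id ℝ C(Icc 0 L, ℝ) := by
    have h1 : HasFDerivAt (fun ω : C(Icc 0 L, ℝ) => F ((0, p₀), ω))
        (fderiv ℝ F ((0, p₀), 0) ∘L .inr ℝ (ℝ × P) C(Icc 0 L, ℝ)) 0 := by
      have := (hFc.differentiableAt hn').hasFDerivAt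
      exact HasFDerivAt.comp (0 : C(Icc 0 L, ℝ)) this (hasFDerivAt_prodMk_right _ _)
    refine h1.unique ?_
    have h2 : DifferentiableAt ℝ (fun ω : C(Icc 0 L, ℝ) => N (p₀, e * ω) - k) 0 := by
      have := (hNc.differentiableAt hn').hasFDerivAt
      have := HasFDerivAt.comp (0 : C(Icc 0 L, ℝ)) this (hasFDerivAt_prodMk_right (0, p₀) _)
      exact this.differentiableAt.sub_const k
    have h3 := (hasFDerivAt_id (𝕜 := ℝ) (0 : C(Icc 0 L, ℝ))).mul h2.hasFDerivAt
    have h4 := ((hasFDerivAt_id (𝕜 := ℝ) (0 : C(Icc 0 L, ℝ))).sub_const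
      ((0 : ℝ) • (1 : C(Icc 0 L, ℝ)))).sub (J.hasFDerivAt.comp _ h3)
    convert! h4 using 1
    ext1 ω
    simp [hk]
  have hinv : (fderiv ℝ F ((0, p₀), 0) ∘L .inr ℝ (ℝ × P) C(Icc 0 L, ℝ)).IsInvertible := by
    rw [hid]; exact ⟨ContinuousLinearEquiv.refl ℝ _, rfl⟩
  set ψ := hFc.implicitFunction hn' hinv with hψ
  have hψc : ContDiffAt ℝ n ψ (0, p₀) := hFc.contDiffAt_implicitFunction hn' hinv
  have hψ0 : ψ (0, p₀) = 0 := hFc.implicitFunction_apply_self hn' hinv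
  have hψF : ∀ᶠ x in 𝓝 (0, p₀), F (x, ψ x) = 0 := by
    simpa [hF0] using hFc.eventually_apply_implicitFunction hn' hinv
  have hψu : ∀ᶠ v in 𝓝 ((0, p₀), (0 : C(Icc 0 L, ℝ))), F v = 0 → ψ v.1 = v.2 := by
    filter_upwards [hFc.eventually_apply_eq_iff_implicitFunction hn' hinv] with v hv h0
    exact hv.1 (h0.trans hF0.symm)
  have hNM' : ∀ᶠ v in 𝓝 (((0 : ℝ), p₀), (0 : C(Icc 0 L, ℝ))), ∀ t,
      N (v.1.2, e * v.2) t = M v.1.2 (ee t * v.2 t) t := by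
    have : Tendsto (fun v : (ℝ × P) × C(Icc 0 L, ℝ) => (v.1.2, e * v.2)) (𝓝 ((0, p₀), 0))
        (𝓝 (p₀, 0)) := by
      have : Continuous (fun v : (ℝ × P) × C(Icc 0 L, ℝ) => (v.1.2, e * v.2)) := by fun_prop
      simpa using this.tendsto ((0, p₀), 0)
    filter_upwards [this.eventually hNM] with v hv t 
    rw [hv t, ContinuousMap.mul_apply, he]
  refine ⟨fun x => ee L * ψ x ⟨L, right_mem_Icc.2 hL⟩, ?_⟩
  have hboth := hψu.and hNM'
  rw [nhds_prod_eq, nhds_prod_eq, eventually_prod_iff] at hboth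
  obtain ⟨pa, hpa, pb, hpb, hab⟩ := hboth
  obtain ⟨pc, hpc, pd, hpd, hcd⟩ := eventually_prod_iff.1 hpa
  obtain ⟨δ₁, hδ₁, hb₁⟩ := Metric.eventually_nhds_iff_ball.1 hpb
  obtain ⟨δ₂, hδ₂, hb₂⟩ := Metric.eventually_nhds_iff_ball.1 hpc
  have hE : 0 < ‖ei‖ + 1 := by positivity
  refine ⟨min δ₂ (δ₁ / (‖ei‖ + 1)), by positivity, ?_, ?_, ?_⟩
  · have : ContDiffAt ℝ n (fun x => ψ x ⟨L, right_mem_Icc.2 hL⟩) (0, p₀) :=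
      (ContinuousMap.evalCLM ℝ (M := ℝ)
        (⟨L, right_mem_Icc.2 hL⟩ : Icc 0 L)).contDiff.contDiffAt.comp _ hψc
    exact contDiffAt_const.mul this
  · filter_upwards [hpd] with p hp R hR
    have hRc : ContinuousOn R (Icc 0 L) := fun t ht => (hR t ht).1.continuousAt.continuousWithinAt
    obtain ⟨r, hr⟩ : ∃ r : C(Icc 0 L, ℝ), ∀ t, r t = R t :=
      ⟨⟨fun t => R t, continuousOn_iff_continuous_domRestrict.1 hRc⟩, fun t => rfl⟩
    have hrn : ‖ei * r‖ < δ₁ := by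
      have h1 : ‖r‖ ≤ δ₁ / (‖ei‖ + 1) :=
        (ContinuousMap.norm_le _ (by positivity)).2 fun t => by
          rw [hr]; exact (hR t t.2).2.le.trans (min_le_right _ _)
      calc ‖ei * r‖ ≤ ‖ei‖ * ‖r‖ := norm_mul_le _ _
        _ ≤ ‖ei‖ * (δ₁ / (‖ei‖ + 1)) := by gcongr
        _ < δ₁ := by
          rw [← mul_div_assoc, div_lt_iff₀ hE]
          nlinarith
    have hv := hab (hcd (x := R 0) (hb₂ _ (by
      simpa using (hR 0 (left_mem_Icc.2 hL)).2.trans_le (min_le_left _ _))) hp)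
      (hb₁ (ei * r) (by simpa using hrn))
    have hNr : ∀ t : Icc 0 L, N (p, e * (ei * r)) t = M p (R t) t := fun t => by
      rw [hv.2 t, ContinuousMap.mul_apply, hei, hr, mul_inv_cancel_left₀ (Real.exp_pos _).ne']
    have h0 : F ((R 0, p), ei * r) = 0 := by
      ext t
      set f := (ei * r) * (N (p, e * (ei * r)) - k) with hf
      have hft : ∀ t, f t = (ee t)⁻¹ * R t * (M p (R t) t - k t) := fun t => by
        rw [hf, ContinuousMap.mul_apply, ContinuousMap.sub_apply, hNr, ContinuousMap.mul_apply,
          hei, hr]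
      have hder : ∀ s ∈ uIcc 0 (t : ℝ), HasDerivAt (fun s => (ee s)⁻¹ * R s)
          (IccExtend hL f s) s := by
        intro s hs
        rw [uIcc_of_le t.2.1] at hs
        have hs' : s ∈ Icc 0 L := ⟨hs.1, hs.2.trans t.2.2⟩
        have hne : ee s ≠ 0 := (Real.exp_pos _).ne'
        have h1 := ((hee' s).inv hne).mul (hR s hs').1
        convert! h1 using 1
        rw [IccExtend_of_mem _ _ hs', IccExtend_of_mem _ _ hs']
        rw [hft, Pi.inv_apply]
        field_simp
        ring
      have := intervalIntegral.integral_eq_sub_of_hasDerivAt hder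
        ((f.continuous.Icc_extend' (h := hL)).intervalIntegrable _ _)
      have h00 : ee 0 = 1 := by simp [hee]
      simp only [hF, ContinuousMap.sub_apply, J, integrationCLM_apply]
      rw [← hf, this, h00]
      simp [hei, hr]
    have := hv.1 h0
    simp only at this
    rw [this, ContinuousMap.mul_apply, hei, hr, mul_inv_cancel_left₀ (Real.exp_pos _).ne']
  · intro η' hη'
    have hc : ContinuousAt (fun ρ : ℝ => ((ρ, p₀), ψ (ρ, p₀))) 0 := by
      refine ContinuousAt.prodMk (by fun_prop) ?_
      exact ContinuousAt.comp (f := fun ρ : ℝ => (ρ, p₀)) hψc.continuousAt (by fun_prop)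
    have hc1 : ContinuousAt (fun ρ : ℝ => e * ψ (ρ, p₀)) 0 := by
      exact continuousAt_const.mul hc.snd
    have hsmall : ∀ᶠ ρ in 𝓝 (0 : ℝ), ‖e * ψ (ρ, p₀)‖ < η' := by
      refine hc1.norm.eventually_lt continuousAt_const ?_
      simpa [hψ0] using hη'
    have ht1 : Tendsto (fun ρ : ℝ => (ρ, p₀)) (𝓝 0) (𝓝 (0, p₀)) :=
      Continuous.tendsto (by fun_prop) 0
    have ht2 : Tendsto (fun ρ : ℝ => ((ρ, p₀), ψ (ρ, p₀))) (𝓝 0) (𝓝 ((0, p₀), 0)) := by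
      simpa [ContinuousAt, hψ0] using hc
    filter_upwards [hsmall, ht1.eventually hψF, ht2.eventually hNM'] with ρ h1 h2 h3
    set ω := ψ (ρ, p₀) with hω
    set Ω : ℝ → ℝ := fun t => ρ + ∫ s in (0 : ℝ)..t, IccExtend hL (ω * (N (p₀, e * ω) - k)) s
    have hΩ : ∀ t : Icc 0 L, Ω t = ω t := fun t => by
      have := congrArg (fun f : C(Icc 0 L, ℝ) => f t) h2
      simp only [hF, ContinuousMap.sub_apply, J, integrationCLM_apply] at this
      simp only [ContinuousMap.coe_smul, Pi.smul_apply, ContinuousMap.one_apply, smul_eq_mul,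
        mul_one, ContinuousMap.zero_apply] at this
      simp only [Ω]
      linarith
    refine ⟨fun t => ee t * Ω t, by simp [hee, Ω], ?_, fun t ht => ⟨?_, ?_⟩⟩
    · have := hΩ ⟨L, right_mem_Icc.2 hL⟩
      simp only at this
      simp only [this]
    · have hd := (hee' t).mul ((hasDerivAt_integral_IccExtend hL
        (ω * (N (p₀, e * ω) - k)) t).const_add ρ)
      have h4 := hΩ ⟨t, ht⟩
      have h5 := h3 ⟨t, ht⟩
      convert! hd using 1
      rw [IccExtend_of_mem _ _ ht, IccExtend_of_mem _ _ ht]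
      simp only [ContinuousMap.mul_apply, ContinuousMap.sub_apply, h5]
      change _ = ee t * k ⟨t, ht⟩ * Ω t + _
      simp only at h4
      rw [h4]
      ring
    · have h4 := hΩ ⟨t, ht⟩
      simp only at h4
      simp only [h4]
      rw [← he ⟨t, ht⟩]
      exact ((e * ω).norm_coe_le_norm ⟨t, ht⟩).trans h1.le

end HalfMap

/-- `x' / r²` in the quasi-polar coordinates `x = r s`, `y = r² c`. -/
def polarP (p : ℝ × ℝ × ℝ) (r s c : ℝ) : ℝ :=
  -c + p.1 * s ^ 2 + p.2.1 * r * s * c + p.2.2 * r ^ 2 * c ^ 2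

/-- `y' / r³` in the quasi-polar coordinates `x = r s`, `y = r² c`. -/
def polarQ (r s c : ℝ) : ℝ := s ^ 3 + r ^ 2 * s * c ^ 2 + r ^ 3 * c ^ 3

/-- The (rescaled, negated) angular component of the vector field. -/
def polarDelta (p : ℝ × ℝ × ℝ) (r s c : ℝ) : ℝ := s * polarQ r s c - 2 * c * polarP p r s c

/-- The (rescaled) radial component of the vector field. -/
def polarNum (p : ℝ × ℝ × ℝ) (r s c : ℝ) : ℝ := s * polarP p r s c + c * polarQ r s c

/-- The logarithmic derivative of the radius with respect to the angle. -/
noncomputable def polarM (p : ℝ × ℝ × ℝ) (r τ : ℝ) : ℝ :=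
  -polarNum p r (Real.sin τ) (Real.cos τ) / polarDelta p r (Real.sin τ) (Real.cos τ)

theorem polarDelta_pos {p : ℝ × ℝ × ℝ} (hp : p.1 ^ 2 < 2) {s c : ℝ} (h : s ^ 2 + c ^ 2 = 1) :
    0 < polarDelta p 0 s c := by
  have h1 : polarDelta p 0 s c = (s ^ 2 - p.1 * c) ^ 2 + (2 - p.1 ^ 2) * c ^ 2 := by
    simp only [polarDelta, polarP, polarQ]; ring
  rw [h1]
  rcases eq_or_ne c 0 with rfl | hc
  · have : s ^ 2 = 1 := by linarith
    simp [this]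
  · have : 0 < c ^ 2 := by positivity
    nlinarith [sq_nonneg (s ^ 2 - p.1 * c), mul_pos (sub_pos.2 hp) this]

theorem isCompact_circle : IsCompact {z : ℝ × ℝ | z.1 ^ 2 + z.2 ^ 2 = 1} := by
  refine Metric.isCompact_of_isClosed_isBounded
    (isClosed_eq (by fun_prop) continuous_const) ?_
  refine (isBounded_closedBall (x := (0 : ℝ × ℝ)) (r := 1)).subset fun z hz => ?_
  simp only [mem_ofPred_eq] at hz
  rw [mem_closedBall_zero_iff, Prod.norm_def]
  refine max_le (abs_le_of_sq_le_sq (by nlinarith [sq_nonneg z.2]) zero_le_one) 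
    (abs_le_of_sq_le_sq (by nlinarith [sq_nonneg z.1]) zero_le_one)

/-- Near `p₀`, the angular component is bounded below for small radii. -/
theorem exists_polarDelta_ge {p₀ : ℝ × ℝ × ℝ} (hp : p₀.1 ^ 2 < 2) :
    ∃ m > 0, ∃ η > 0, ∀ᶠ p in 𝓝 p₀, ∀ r, |r| < η → ∀ s c : ℝ, s ^ 2 + c ^ 2 = 1 →
      m ≤ polarDelta p r s c := by
  obtain ⟨z₀, hz₀, hmin⟩ := isCompact_circle.exists_isMinOn (f := fun z => polarDelta p₀ 0 z.1 z.2)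
    ⟨(1, 0), by simp⟩ (by unfold polarDelta polarP polarQ; fun_prop)
  set m := polarDelta p₀ 0 z₀.1 z₀.2
  have hm : 0 < m := polarDelta_pos hp hz₀
  have key : ∀ᶠ q in 𝓝 (p₀, (0 : ℝ)), ∀ z ∈ {z : ℝ × ℝ | z.1 ^ 2 + z.2 ^ 2 = 1},
      m / 2 < polarDelta q.1 q.2 z.1 z.2 := by
    refine isCompact_circle.eventually_forall_of_forall_eventually fun z hz => ?_
    have hc : Continuous fun w : (ℝ × ℝ) × ((ℝ × ℝ × ℝ) × ℝ) =>
        polarDelta w.2.1 w.2.2 w.1.1 w.1.2 := by unfold polarDelta polarP polarQ; fun_prop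
    have hlt : m / 2 < polarDelta p₀ 0 z.1 z.2 := by
      have h1 : m ≤ polarDelta p₀ 0 z.1 z.2 := hmin hz
      linarith
    refine continuousAt_const.eventually_lt
      (Continuous.continuousAt (x := ((p₀, (0 : ℝ)), z))
          (by unfold polarDelta polarP polarQ; fun_prop)) hlt
  rw [nhds_prod_eq, eventually_prod_iff] at key
  obtain ⟨pa, ha, pb, hb, hab⟩ := key
  obtain ⟨η, hη, hball⟩ := Metric.eventually_nhds_iff_ball.1 hb
  refine ⟨m / 2, by positivity, η, hη, ha.mono fun p hpp r hr s c hsc => ?_⟩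
  exact (hab hpp (hball r (by simpa using hr)) (s, c) hsc).le

/-- The half-turn map in quasi-polar coordinates is smooth. -/
theorem exists_polar_half_map {p₀ : ℝ × ℝ × ℝ} (hp : p₀.1 ^ 2 < 2) :
    ∃ (φ : ℝ × (ℝ × ℝ × ℝ) → ℝ) (η : ℝ), 0 < η ∧ ContDiffAt ℝ (9 : ℕ) φ (0, p₀) ∧
      (∀ᶠ p in 𝓝 p₀, ∀ R : ℝ → ℝ,
        (∀ t ∈ Icc 0 Real.pi, HasDerivAt R (R t * polarM p (R t) t) t ∧ |R t| < η) →
          φ (R 0, p) = R Real.pi) ∧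
      (∀ η' > 0, ∀ᶠ ρ in 𝓝 (0 : ℝ), ∃ R : ℝ → ℝ, R 0 = ρ ∧ φ (ρ, p₀) = R Real.pi ∧
        ∀ t ∈ Icc 0 Real.pi, HasDerivAt R (R t * polarM p₀ (R t) t) t ∧ |R t| ≤ η') := by
  obtain ⟨s, hs⟩ : ∃ s : C(Icc 0 Real.pi, ℝ), ∀ t, s t = Real.sin t :=
    ⟨⟨fun t => Real.sin t, by fun_prop⟩, fun t => rfl⟩
  obtain ⟨c, hc⟩ : ∃ c : C(Icc 0 Real.pi, ℝ), ∀ t, c t = Real.cos t :=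
    ⟨⟨fun t => Real.cos t, by fun_prop⟩, fun t => rfl⟩
  set X := (ℝ × ℝ × ℝ) × C(Icc 0 Real.pi, ℝ)
  obtain ⟨Pf, hPf⟩ : ∃ Pf : X → C(Icc 0 Real.pi, ℝ), Pf = fun q =>
    -c + q.1.1 • s ^ 2 + q.1.2.1 • (q.2 * s * c) + q.1.2.2 • (q.2 ^ 2 * c ^ 2) := ⟨_, rfl⟩
  obtain ⟨Qf, hQf⟩ : ∃ Qf : X → C(Icc 0 Real.pi, ℝ), Qf = fun q =>
    s ^ 3 + q.2 ^ 2 * s * c ^ 2 + q.2 ^ 3 * c ^ 3 := ⟨_, rfl⟩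
  have hPc : ContDiff ℝ (9 : ℕ) Pf := by rw [hPf]; fun_prop
  have hQc : ContDiff ℝ (9 : ℕ) Qf := by rw [hQf]; fun_prop
  have hPv : ∀ q t, Pf q t = polarP q.1 (q.2 t) (Real.sin t) (Real.cos t) := fun q t => by
    simp [hPf, hs, hc, polarP]; ring
  have hQv : ∀ q t, Qf q t = polarQ (q.2 t) (Real.sin t) (Real.cos t) := fun q t => by
    simp [hQf, hs, hc, polarQ]
  obtain ⟨Df, hDf⟩ : ∃ Df : X → C(Icc 0 Real.pi, ℝ), Df = fun q =>
    s * Qf q - (2 : ℝ) • (c * Pf q) := ⟨_, rfl⟩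
  obtain ⟨Nf, hNf⟩ : ∃ Nf : X → C(Icc 0 Real.pi, ℝ), Nf = fun q =>
    s * Pf q + c * Qf q := ⟨_, rfl⟩
  have hDc : ContDiff ℝ (9 : ℕ) Df := by rw [hDf]; fun_prop
  have hNc : ContDiff ℝ (9 : ℕ) Nf := by rw [hNf]; fun_prop
  have hDv : ∀ q t, Df q t = polarDelta q.1 (q.2 t) (Real.sin t) (Real.cos t) := fun q t => by
    simp [hDf, hs, hc, hPv, hQv, polarDelta]; ring
  have hNv : ∀ q t, Nf q t = polarNum q.1 (q.2 t) (Real.sin t) (Real.cos t) := fun q t => by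
    simp [hNf, hs, hc, hPv, hQv, polarNum]
  have hunit : IsUnit (Df (p₀, 0)) := by
    rw [ContinuousMap.isUnit_iff_forall_ne_zero]
    intro t
    rw [hDv]
    exact (polarDelta_pos hp (Real.sin_sq_add_cos_sq t)).ne'
  have hunit' : ∀ᶠ q in 𝓝 (p₀, (0 : C(Icc 0 Real.pi, ℝ))), IsUnit (Df q) := by
    have := (Units.isOpen (R := C(Icc 0 Real.pi, ℝ))).mem_nhds hunit
    exact hDc.continuous.continuousAt.eventually_mem this
  refine exists_smooth_transition_map Real.pi_pos.le 9 (by norm_num) p₀ polarM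
    (fun q => -Nf q * Ring.inverse (Df q)) ?_ ?_
  · obtain ⟨u, hu⟩ := hunit
    refine hNc.neg.contDiffAt.mul (ContDiffAt.comp (g := Ring.inverse) _ ?_ hDc.contDiffAt)
    rw [← hu]
    exact contDiffAt_ringInverse ℝ u
  · filter_upwards [hunit'] with q hq t
    have h1 := congrArg (fun f : C(Icc 0 Real.pi, ℝ) => f t) (Ring.mul_inverse_cancel _ hq)
    simp only [ContinuousMap.mul_apply, ContinuousMap.one_apply] at h1
    have h2 : Df q t ≠ 0 := left_ne_zero_of_mul_eq_one h1
    rw [ContinuousMap.mul_apply, eq_div_of_mul_eq h2 ((mul_comm _ _).trans h1),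
      ContinuousMap.neg_apply, hNv, hDv, polarM]
    ring

theorem IsSol42.continuous {A B C : ℝ} {γ : ℝ → ℝ × ℝ} (h : IsSol42 A B C γ) : Continuous γ :=
  continuous_iff_continuousAt.2 fun t =>
    (h t).1.continuousAt.prodMk (h t).2.continuousAt

/-- Bounded solutions of (4.2) through a common point are translates of each other. -/
theorem IsSol42.eq_of_eq {A B C : ℝ} {γ₁ γ₂ : ℝ → ℝ × ℝ} (h₁ : IsSol42 A B C γ₁)
    (h₂ : IsSol42 A B C γ₂) (hb₁ : Bornology.IsBounded (range γ₁))
    (hb₂ : Bornology.IsBounded (range γ₂)) {t₁ t₂ : ℝ} (h : γ₁ t₁ = γ₂ t₂) (s : ℝ) :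
    γ₁ (t₁ + s) = γ₂ (t₂ + s) := by
  obtain ⟨r, hr⟩ := (hb₁.union hb₂).subset_closedBall (0 : ℝ × ℝ)
  set v : ℝ × ℝ → ℝ × ℝ := fun z =>
    (-z.2 + A * z.1 ^ 2 + B * z.1 * z.2 + C * z.2 ^ 2, z.1 ^ 3 + z.1 * z.2 ^ 2 + z.2 ^ 3) with hv
  obtain ⟨K, hK⟩ := ContDiffOn.exists_lipschitzOnWith (n := 1) (f := v)
    (s := closedBall (0 : ℝ × ℝ) r) (by rw [hv]; fun_prop) one_ne_zero
    (convex_closedBall _ _) (isCompact_closedBall _ _)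
  have hd : ∀ {γ : ℝ → ℝ × ℝ}, IsSol42 A B C γ → ∀ a t,
      HasDerivAt (fun s => γ (a + s)) (v (γ (a + t))) t := fun hγ a t =>
    ((hγ (a + t)).1.prodMk (hγ (a + t)).2).comp_const_add a t
  have := ODE_solution_unique_univ (v := fun _ => v) (s := fun _ => closedBall (0 : ℝ × ℝ) r)
    (K := K) (f := fun s => γ₁ (t₁ + s)) (g := fun s => γ₂ (t₂ + s)) (t₀ := 0) (fun _ => hK)
    (fun t => ⟨hd h₁ t₁ t, hr (Or.inl ⟨_, rfl⟩)⟩) (fun t => ⟨hd h₂ t₂ t, hr (Or.inr ⟨_, rfl⟩)⟩)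
    (by simpa using h)
  exact congrFun this s

theorem IsSol42.range_eq_of_eq {A B C : ℝ} {γ₁ γ₂ : ℝ → ℝ × ℝ} (h₁ : IsSol42 A B C γ₁)
    (h₂ : IsSol42 A B C γ₂) (hb₁ : Bornology.IsBounded (range γ₁))
    (hb₂ : Bornology.IsBounded (range γ₂)) {t₁ t₂ : ℝ} (h : γ₁ t₁ = γ₂ t₂) :
    range γ₁ = range γ₂ := by
  have key := h₁.eq_of_eq h₂ hb₁ hb₂ h
  ext z
  constructor
  · rintro ⟨t, rfl⟩
    exact ⟨t₂ + (t - t₁), by rw [← key]; congr 1; ring⟩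
  · rintro ⟨t, rfl⟩
    exact ⟨t₁ + (t - t₂), by rw [key]; congr 1; ring⟩

theorem IsSol42.ne_zero {A B C : ℝ} {γ : ℝ → ℝ × ℝ} (h : IsSol42 A B C γ)
    (hb : Bornology.IsBounded (range γ)) (hne : ∃ t, γ t ≠ γ 0) (t : ℝ) : γ t ≠ 0 := by
  intro h0
  have hz : IsSol42 A B C fun _ => 0 := fun t => by
    constructor
    · convert! hasDerivAt_const t (0 : ℝ) using 1
      simp
    · convert! hasDerivAt_const t (0 : ℝ) using 1
      simp
  have key := h.eq_of_eq hz hb (by simp) (t₂ := 0) h0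
  obtain ⟨s, hs⟩ := hne
  apply hs
  have h1 := key (s - t)
  have h2 := key (0 - t)
  simp only [add_sub_cancel] at h1 h2
  rw [h1, h2]

/-- The quasi-homogeneous radius: the positive `r` with `(x / r)² + (y / r²)² = 1`. -/
noncomputable def quasiRadius (z : ℝ × ℝ) : ℝ :=
  Real.sqrt ((z.1 ^ 2 + Real.sqrt (z.1 ^ 4 + 4 * z.2 ^ 2)) / 2)

theorem continuous_quasiRadius : Continuous quasiRadius := by
  unfold quasiRadius; fun_prop

theorem quasiRadius_pow_four (z : ℝ × ℝ) :
    quasiRadius z ^ 4 = z.1 ^ 2 * quasiRadius z ^ 2 + z.2 ^ 2 := by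
  have h1 : quasiRadius z ^ 2 = (z.1 ^ 2 + Real.sqrt (z.1 ^ 4 + 4 * z.2 ^ 2)) / 2 :=
    Real.sq_sqrt (by positivity)
  have h2 : Real.sqrt (z.1 ^ 4 + 4 * z.2 ^ 2) ^ 2 = z.1 ^ 4 + 4 * z.2 ^ 2 :=
    Real.sq_sqrt (by positivity)
  rw [show quasiRadius z ^ 4 = (quasiRadius z ^ 2) ^ 2 by ring, h1]
  nlinarith

theorem quasiRadius_inner_pos {z : ℝ × ℝ} (hz : z ≠ 0) : 0 < z.1 ^ 4 + 4 * z.2 ^ 2 := by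
  rcases eq_or_ne z.1 0 with h | h
  · have : z.2 ≠ 0 := fun h' => hz (Prod.ext h h')
    positivity
  · positivity

theorem quasiRadius_pos {z : ℝ × ℝ} (hz : z ≠ 0) : 0 < quasiRadius z := by
  have := Real.sqrt_pos.2 (quasiRadius_inner_pos hz)
  exact Real.sqrt_pos.2 (by positivity)

theorem differentiableAt_quasiRadius {γ : ℝ → ℝ × ℝ} {t : ℝ}
    (hx : DifferentiableAt ℝ (fun s => (γ s).1) t)
    (hy : DifferentiableAt ℝ (fun s => (γ s).2) t) (h0 : γ t ≠ 0) :
    DifferentiableAt ℝ (fun s => quasiRadius (γ s)) t := by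
  have h1 := quasiRadius_inner_pos h0
  have h2 := Real.sqrt_pos.2 h1
  unfold quasiRadius
  refine DifferentiableAt.sqrt ?_ (by positivity)
  refine ((hx.pow 2).add (DifferentiableAt.sqrt ?_ h1.ne')).div_const 2
  fun_prop

/-- Equations of motion in quasi-polar coordinates. -/
theorem IsSol42.hasDerivAt_polar {p : ℝ × ℝ × ℝ} {γ : ℝ → ℝ × ℝ} (h : IsSol42 p.1 p.2.1 p.2.2 γ)
    {r S c : ℝ → ℝ} (hr : ∀ t, r t = quasiRadius (γ t)) (hS : ∀ t, S t = (γ t).1 / r t)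
    (hc : ∀ t, c t = (γ t).2 / r t ^ 2) (hne : ∀ t, γ t ≠ 0) (t : ℝ) :
    S t ^ 2 + c t ^ 2 = 1 ∧
    HasDerivAt r (r t ^ 2 * polarNum p (r t) (S t) (c t) / (1 + c t ^ 2)) t ∧
    HasDerivAt S (c t * (-(r t * polarDelta p (r t) (S t) (c t)) / (1 + c t ^ 2))) t ∧
    HasDerivAt c (-S t * (-(r t * polarDelta p (r t) (S t) (c t)) / (1 + c t ^ 2))) t := by
  have hpos : ∀ t, 0 < r t := fun t => by rw [hr]; exact quasiRadius_pos (hne t)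
  have hx : ∀ t, (γ t).1 = r t * S t := fun t => by
    have := (hpos t).ne'
    rw [hS]; field_simp
  have hy : ∀ t, (γ t).2 = r t ^ 2 * c t := fun t => by
    have := (hpos t).ne'
    rw [hc]; field_simp
  have h4 : ∀ t, r t ^ 4 = (γ t).1 ^ 2 * r t ^ 2 + (γ t).2 ^ 2 := fun t => by
    rw [hr]; exact quasiRadius_pow_four _
  have hcirc : S t ^ 2 + c t ^ 2 = 1 := by
    have h5 := h4 t
    rw [hx, hy] at h5
    have h6 : r t ^ 4 ≠ 0 := (pow_pos (hpos t) 4).ne'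
    refine mul_left_cancel₀ h6 ?_
    linarith
  obtain ⟨hdx, hdy⟩ := h t
  have hrd : HasDerivAt r (deriv r t) t := by
    have : r = fun s => quasiRadius (γ s) := funext hr
    rw [hasDerivAt_deriv_iff, this]
    exact differentiableAt_quasiRadius hdx.differentiableAt hdy.differentiableAt (hne t)
  have hpr := (hpos t)
  have hden : 0 < 1 + c t ^ 2 := by positivity
  have hr' : deriv r t = r t ^ 2 * polarNum p (r t) (S t) (c t) / (1 + c t ^ 2) := by
    have e1 := hrd.pow 4
    have e2 := ((hdx.pow 2).mul (hrd.pow 2)).add (hdy.pow 2)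
    have e3 : r ^ 4 = (fun s => (γ s).1) ^ 2 * r ^ 2 + (fun s => (γ s).2) ^ 2 := funext h4
    rw [e3] at e1
    have e4 := e1.unique e2
    simp only [Pi.pow_apply, hx, hy] at e4
    rw [eq_div_iff hden.ne']
    refine mul_left_cancel₀ (pow_ne_zero 3 hpr.ne') ?_
    simp only [polarNum, polarP, polarQ]
    have hs2 : S t ^ 2 = 1 - c t ^ 2 := by linarith
    push_cast at e4
    norm_num at e4
    linear_combination (1/2) * e4 + deriv r t * r t ^ 3 * hs2
  rw [hr'] at hrd
  refine ⟨hcirc, hrd, ?_, ?_⟩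
  · have hS' : S = (fun s => (γ s).1) / r := funext hS
    have := hdx.div hrd hpr.ne'
    rw [← hS'] at this
    convert! this using 1
    rw [hx, hy]
    simp only [polarNum, polarP, polarQ, polarDelta]
    field_simp
    have hs2 : S t ^ 2 = 1 - c t ^ 2 := by linarith
    linear_combination (-c t + p.1 * S t ^ 2 + p.2.1 * r t * S t * c t +
        p.2.2 * r t ^ 2 * c t ^ 2) * hs2
  · have hc' : c = (fun s => (γ s).2) / r ^ 2 := funext hc
    have := hdy.div (hrd.pow 2) (pow_ne_zero 2 hpr.ne')
    rw [← hc'] at this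
    convert! this using 1
    rw [hx, hy]
    simp only [polarNum, polarP, polarQ, polarDelta]
    simp only [Pi.pow_apply]
    field_simp
    have hs2 : S t ^ 2 = 1 - c t ^ 2 := by linarith
    push_cast
    norm_num
    linear_combination r t * (S t ^ 3 + r t ^ 2 * S t * c t ^ 2 + r t ^ 3 * c t ^ 3) * hs2

/-- A curve on the unit circle has an angle function. -/
theorem exists_angle_lift {S c g : ℝ → ℝ} (hg : Continuous g) (h1 : ∀ t, S t ^ 2 + c t ^ 2 = 1)
    (hS : ∀ t, HasDerivAt S (c t * g t) t) (hc : ∀ t, HasDerivAt c (-S t * g t) t) :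
    ∃ τ : ℝ → ℝ, (∀ t, HasDerivAt τ (g t) t) ∧ (∀ t, S t = Real.sin (τ t)) ∧
      ∀ t, c t = Real.cos (τ t) := by
  set z : ℂ := ⟨c 0, S 0⟩ with hz
  have hn : ‖z‖ = 1 := by
    rw [Complex.norm_def, Complex.normSq_apply]
    simp only [hz]
    rw [Real.sqrt_eq_one]
    linarith [h1 0]
  have hc0 : Real.cos z.arg = c 0 := by simpa [hn] using Complex.norm_mul_cos_arg z
  have hs0 : Real.sin z.arg = S 0 := by simpa [hn] using Complex.norm_mul_sin_arg z
  set τ : ℝ → ℝ := fun t => z.arg + ∫ s in (0 : ℝ)..t, g s with hτ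
  have hτ' : ∀ t, HasDerivAt τ (g t) t := fun t =>
    (intervalIntegral.integral_hasDerivAt_right (hg.intervalIntegrable _ _)
      (hg.stronglyMeasurableAtFilter _ _) hg.continuousAt).const_add _
  have hτ0 : τ 0 = z.arg := by simp [hτ]
  have hD : ∀ t, HasDerivAt
      (fun t => S t * Real.sin (τ t) + c t * Real.cos (τ t)) 0 t := fun t => by
    have := ((hS t).mul (hτ' t).sin).add ((hc t).mul (hτ' t).cos)
    convert! this using 1
    ring
  have hconst : ∀ t, S t * Real.sin (τ t) + c t * Real.cos (τ t) = 1 := fun t => by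
    have := is_const_of_deriv_eq_zero (fun t => (hD t).differentiableAt) (fun t => (hD t).deriv) t 0
    rw [this, hτ0, hc0, hs0]
    nlinarith [h1 0]
  refine ⟨τ, hτ', fun t => ?_, fun t => ?_⟩
  all_goals
    nlinarith [hconst t, h1 t, Real.sin_sq_add_cos_sq (τ t), sq_nonneg (S t - Real.sin (τ t)),
      sq_nonneg (c t - Real.cos (τ t))]

/-- A function whose derivative is bounded above by a negative constant is a diffeomorphism. -/
theorem exists_inverse_of_deriv_le_neg {τ g : ℝ → ℝ} {m : ℝ} (hm : 0 < m) (hg : ∀ t, g t ≤ -m)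
    (hτ : ∀ t, HasDerivAt τ (g t) t) :
    ∃ σ : ℝ → ℝ, (∀ θ, τ (σ θ) = θ) ∧ (∀ t, σ (τ t) = t) ∧
      ∀ θ, HasDerivAt σ (g (σ θ))⁻¹ θ := by
  have hanti : StrictMono fun t => -τ t :=
    strictMono_of_deriv_pos fun t => by
      rw [show deriv (fun t => -τ t) t = -g t from (hτ t).neg.deriv]; linarith [hg t]
  have hmono : Antitone fun t => τ t + m * t := by
    refine antitone_of_hasDerivAt_nonpos (f' := fun t => g t + m * 1)
        (fun t => (hτ t).add ((hasDerivAt_id t).const_mul m)) fun t => ?_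
    simpa using by linarith [hg t]
  have hcont : Continuous fun t => -τ t :=
    continuous_iff_continuousAt.2 fun t => (hτ t).neg.continuousAt
  have hsurj : Function.Surjective fun t => -τ t := by
    refine hcont.surjective ?_ ?_
    · refine tendsto_atTop_mono' atTop (f₁ := fun t => m * t + -τ 0) ?_ 
        (tendsto_atTop_add_const_right _ _ (tendsto_id.const_mul_atTop hm))
      filter_upwards [eventually_ge_atTop 0] with t ht
      have := hmono ht
      simp only at this ⊢; linarith
    · refine tendsto_atBot_mono' atBot (f₁ := fun t => m * t + -τ 0) ?_ 
        (tendsto_atBot_add_const_right _ _ (tendsto_id.const_mul_atBot hm))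
      filter_upwards [eventually_le_atBot 0] with t ht
      have := hmono ht
      simp only at this ⊢; linarith
  set e := hanti.orderIsoOfSurjective _ hsurj
  have he : ∀ t, e t = -τ t := fun t => rfl
  have h1 : ∀ θ, τ (e.symm (-θ)) = θ := fun θ => by
    have := e.apply_symm_apply (-θ)
    rw [he] at this; linarith
  refine ⟨fun θ => e.symm (-θ), h1, fun t => e.symm_apply_apply t, fun θ => ?_⟩
  refine HasDerivAt.of_local_left_inverse ?_ (hτ _) (by linarith [hg (e.symm (-θ))])
    (Eventually.of_forall h1)
  exact (e.symm.continuous.comp continuous_neg).continuousAt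

/-- A continuous function with a period `k * a`, `0 < k`, takes equal values at some two points at
distance `a`. -/
theorem exists_eq_add_of_periodic {R : ℝ → ℝ} (hR : Continuous R) {a : ℝ} {k : ℕ} (hk : 0 < k)
    (hper : Function.Periodic R (k * a)) : ∃ θ, R (θ + a) = R θ := by
  by_contra! hne
  set u : ℝ → ℝ := fun θ => R (θ + a) - R θ with hu
  have huc : Continuous u := by fun_prop
  have hu0 : ∀ θ, u θ ≠ 0 := fun θ => sub_ne_zero.2 (hne θ)
  have hsum : ∑ j ∈ Finset.range k, u (j * a) = 0 := by
    have : ∀ j ∈ Finset.range k, u (j * a) = R ((j + 1 : ℕ) * a) - R ((j : ℕ) * a) := fun j _ => by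
      simp only [hu]; push_cast; congr 2; ring
    rw [Finset.sum_congr rfl this, Finset.sum_range_sub (fun j : ℕ => R (j * a))]
    have := hper 0
    simp only [zero_add] at this
    rw [this]; simp
  have hsign : (∀ θ, 0 < u θ) ∨ ∀ θ, u θ < 0 := by
    by_contra! hh
    obtain ⟨⟨a, ha⟩, b, hb⟩ := hh
    obtain ⟨c, hc⟩ := mem_range_of_exists_le_of_exists_ge huc ⟨a, ha⟩ ⟨b, hb⟩
    exact hu0 c hc
  have hne' : (Finset.range k).Nonempty := Finset.nonempty_range_iff.2 hk.ne'
  rcases hsign with h | h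
  · exact (Finset.sum_pos (f := fun j : ℕ => u (j * a)) (fun j _ => h (j * a)) hne').ne' hsum
  · exact (Finset.sum_neg (f := fun j : ℕ => u (j * a)) (fun j _ => h (j * a)) hne').ne hsum

/-- A periodic solution near the origin gives a positive periodic solution of the polar equation. -/
theorem IsSol42.exists_polar {p : ℝ × ℝ × ℝ} {m η : ℝ} (hm : 0 < m)
    (hΔ : ∀ r, |r| < η → ∀ s c : ℝ, s ^ 2 + c ^ 2 = 1 → m ≤ polarDelta p r s c)
    {γ : ℝ → ℝ × ℝ} {T : ℝ} (hT : 0 < T) (h : IsSol42 p.1 p.2.1 p.2.2 γ)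
    (hper : Function.Periodic γ T) (hne : ∃ t, γ t ≠ γ 0) (hη : ∀ t, quasiRadius (γ t) < η) :
    ∃ R : ℝ → ℝ, (∀ θ, HasDerivAt R (R θ * polarM p (R θ) θ) θ) ∧ (∀ θ, 0 < R θ ∧ R θ < η) ∧
      Function.Periodic R (2 * Real.pi) ∧ ∃ t, γ t = (0, R 0 ^ 2) := by
  have hbdd : Bornology.IsBounded (range γ) := hper.isBounded_of_continuous hT.ne' h.continuous
  have hne0 : ∀ t, γ t ≠ 0 := h.ne_zero hbdd hne
  obtain ⟨r, hr⟩ : ∃ r : ℝ → ℝ, ∀ t, r t = quasiRadius (γ t) := ⟨_, fun t => rfl⟩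
  obtain ⟨S, hS⟩ : ∃ S : ℝ → ℝ, ∀ t, S t = (γ t).1 / r t := ⟨_, fun t => rfl⟩
  obtain ⟨c, hc⟩ : ∃ c : ℝ → ℝ, ∀ t, c t = (γ t).2 / r t ^ 2 := ⟨_, fun t => rfl⟩
  have hrpos : ∀ t, 0 < r t := fun t => by rw [hr]; exact quasiRadius_pos (hne0 t)
  have hpol := h.hasDerivAt_polar hr hS hc hne0
  have hrη : ∀ t, |r t| < η := fun t => by rw [abs_of_pos (hrpos t), hr]; exact hη t
  set g : ℝ → ℝ := fun t => -(r t * polarDelta p (r t) (S t) (c t)) / (1 + c t ^ 2) with hg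
  have hrc : Continuous r := continuous_iff_continuousAt.2 fun t => (hpol t).2.1.continuousAt
  have hSc : Continuous S := continuous_iff_continuousAt.2 fun t => (hpol t).2.2.1.continuousAt
  have hcc : Continuous c := continuous_iff_continuousAt.2 fun t => (hpol t).2.2.2.continuousAt
  have hgc : Continuous g := by
    refine Continuous.div ?_ (by fun_prop) fun t => by positivity
    unfold polarDelta polarP polarQ
    fun_prop
  obtain ⟨τ, hτ, hsin, hcos⟩ := exists_angle_lift hgc (fun t => (hpol t).1)
    (fun t => (hpol t).2.2.1) (fun t => (hpol t).2.2.2)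
  have hrper : Function.Periodic r T := fun t => by rw [hr, hr, hper]
  obtain ⟨_, ⟨t₁, rfl⟩, hmin⟩ := (hrper.compact_of_continuous hT.ne' hrc).exists_isLeast
    (range_nonempty r)
  have hmin' : ∀ t, r t₁ ≤ r t := fun t => hmin ⟨t, rfl⟩
  have hgle : ∀ t, g t ≤ -(r t₁ * m / 2) := fun t => by
    have h1 : m ≤ polarDelta p (r t) (S t) (c t) := hΔ _ (hrη t) _ _ (hpol t).1
    have h2 : r t₁ * m ≤ r t * polarDelta p (r t) (S t) (c t) :=
      mul_le_mul (hmin' t) h1 hm.le (hrpos t).le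
    have h3 : c t ^ 2 ≤ 1 := by nlinarith [(hpol t).1, sq_nonneg (S t)]
    have h4 : 0 < r t₁ * m := mul_pos (hrpos _) hm
    simp only [hg]
    rw [neg_div, neg_le_neg_iff]
    exact div_le_div₀ (h4.le.trans h2) h2 (by positivity) (by linarith)
  obtain ⟨σ, hτσ, hστ, hσ⟩ := exists_inverse_of_deriv_le_neg
    (by have := hrpos t₁; positivity) hgle hτ
  have hγ : ∀ t, γ t = (r t * Real.sin (τ t), r t ^ 2 * Real.cos (τ t)) := fun t => by
    have h1 := (hrpos t).ne'
    rw [← hsin, ← hcos, hS, hc]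
    ext <;> simp <;> field_simp
  set R : ℝ → ℝ := fun θ => r (σ θ) with hR
  have hRder : ∀ θ, HasDerivAt R (R θ * polarM p (R θ) θ) θ := fun θ => by
    have h1 := (hpol (σ θ)).2.1.comp θ (hσ θ)
    refine h1.congr_deriv ?_
    have h2 : 0 < polarDelta p (r (σ θ)) (S (σ θ)) (c (σ θ)) :=
      hm.trans_le (hΔ _ (hrη _) _ _ (hpol _).1)
    have h3 : (1 + c (σ θ) ^ 2) ≠ 0 := by positivity
    have h4 := hrpos (σ θ)
    have h5 : Real.sin θ = S (σ θ) := by rw [hsin, hτσ]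
    have h6 : Real.cos θ = c (σ θ) := by rw [hcos, hτσ]
    simp only [hg, hR, polarM, h5, h6]
    field_simp
  have hRc : Continuous R := continuous_iff_continuousAt.2 fun θ => (hRder θ).continuousAt
  have hshift : ∀ a b : ℝ, (∀ t, γ (a + t) = γ (b + t)) →
      ∀ t, τ (a + t) - τ (b + t) = τ a - τ b := by
    intro a b hab t
    have hgab : ∀ t, g (a + t) = g (b + t) := fun t => by
      simp only [hg, hS, hc, hr, hab]
    have hD : ∀ t, HasDerivAt (fun t => τ (a + t) - τ (b + t)) 0 t := fun t => by
      have := ((hτ (a + t)).comp_const_add a t).sub ((hτ (b + t)).comp_const_add b t)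
      rw [hgab, sub_self] at this
      exact this
    have := is_const_of_deriv_eq_zero (fun t => (hD t).differentiableAt)
      (fun t => (hD t).deriv) t 0
    simpa using this
  have hanti : ∀ s t, s < t → τ t < τ s := by
    have : StrictAnti τ := strictAnti_of_deriv_neg fun t => by
      rw [(hτ t).deriv]
      have := mul_pos (hrpos t₁) hm
      linarith [hgle t]
    exact fun s t hst => this hst
  obtain ⟨k, hk⟩ : ∃ k : ℤ, k * (2 * Real.pi) = τ 0 - τ T := by
    rw [← Real.cos_eq_one_iff, Real.cos_sub, ← hcos, ← hcos, ← hsin, ← hsin]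
    have e : γ T = γ 0 := by simpa using hper 0
    have e1 : S T = S 0 := by rw [hS, hS, hr, hr, e]
    have e2 : c T = c 0 := by rw [hc, hc, hr, hr, e]
    rw [e1, e2]
    linarith [(hpol 0).1]
  have hkpos : 0 < k := by
    have h1 := hanti 0 T hT
    have h2 : 0 < (k : ℝ) * (2 * Real.pi) := by rw [hk]; linarith
    have h3 : (0 : ℝ) < k := pos_of_mul_pos_left h2 (by positivity)
    exact_mod_cast h3
  obtain ⟨n, rfl⟩ := Int.eq_ofNat_of_zero_le hkpos.le
  have hRn : Function.Periodic R (n * (2 * Real.pi)) := fun θ => by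
    have h1 := hshift 0 T
        (fun t => by rw [zero_add, add_comm T t, hper]) (σ (θ + n * (2 * Real.pi)))
    rw [zero_add, hτσ] at h1
    have h2 : τ (T + σ (θ + n * (2 * Real.pi))) = θ := by
      rw [← hk] at h1
      push_cast at h1
      linarith
    have h3 : σ θ = T + σ (θ + n * (2 * Real.pi)) := by rw [← hστ (T + _), h2]
    simp only [hR]
    rw [h3, add_comm T, hrper]
  obtain ⟨θ₀, hθ₀⟩ := exists_eq_add_of_periodic hRc (by exact_mod_cast hkpos) hRn
  have hγθ : ∀ θ, γ (σ θ) = (R θ * Real.sin θ, R θ ^ 2 * Real.cos θ) := fun θ => by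
    rw [hγ, hτσ]
  have hmeet : γ (σ (θ₀ + 2 * Real.pi)) = γ (σ θ₀) := by
    rw [hγθ, hγθ, hθ₀, Real.sin_add_two_pi, Real.cos_add_two_pi]
  have htrans := h.eq_of_eq h hbdd hbdd hmeet
  refine ⟨R, hRder, fun θ => ⟨hrpos _, (le_abs_self _).trans_lt (hrη _)⟩, fun θ => ?_, σ 0, ?_⟩
  · have h1 := hshift _ _ htrans (σ θ - σ θ₀)
    rw [add_sub_cancel, hτσ, hτσ, hτσ] at h1
    have h2 : σ (θ + 2 * Real.pi) = σ (θ₀ + 2 * Real.pi) + (σ θ - σ θ₀) := by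
      rw [← hστ (σ (θ₀ + 2 * Real.pi) + _)]
      congr 1
      linarith
    have h3 := htrans (σ θ - σ θ₀)
    rw [add_sub_cancel] at h3
    simp only [hR]
    rw [h2, hr, h3, ← hr]
  · rw [hγθ]; simp

/-- `R` is a solution of the polar equation over a half turn, bounded by `η`. -/
def IsHalfTurn (p : ℝ × ℝ × ℝ) (η : ℝ) (R : ℝ → ℝ) : Prop :=
  ∀ t ∈ Icc 0 Real.pi, HasDerivAt R (R t * polarM p (R t) t) t ∧ |R t| ≤ η

/-- The two half turns starting at `ρ` and `-ρ` fail to close up by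
at least a multiple of `ρ ^ 8`. -/
def HasReturnGap (p : ℝ × ℝ × ℝ) : Prop :=
  ∃ η > 0, ∃ c > 0, ∀ᶠ ρ in 𝓝[>] (0 : ℝ), ∀ R₁ R₂ : ℝ → ℝ, R₁ 0 = ρ → R₂ 0 = -ρ →
    IsHalfTurn p η R₁ → IsHalfTurn p η R₂ → c * ρ ^ 8 ≤ |R₁ Real.pi + R₂ Real.pi|

/-- A half turn stays comparable to its starting point. -/
theorem exists_halfTurn_bounds {w m : ℝ → ℝ} {c : ℝ} (hc : 0 ≤ c) (h0 : w 0 = 1)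
    (hw : ∀ t ∈ Icc 0 Real.pi, HasDerivAt w (w t * m t) t)
    (hm : ∀ t ∈ Icc 0 Real.pi, |m t| ≤ c) :
    ∀ t ∈ Icc 0 Real.pi, w t ∈ Icc (Real.exp (-(c * Real.pi))) (Real.exp (c * Real.pi)) := by
  have hE : ∀ a t : ℝ, HasDerivAt (fun t => Real.exp (a * t)) (Real.exp (a * t) * a) t :=
      fun a t => by
    simpa using ((hasDerivAt_id t).const_mul a).exp
  have hd : ∀ a : ℝ, ∀ t ∈ Icc 0 Real.pi, HasDerivAt (fun t => w t ^ 2 * Real.exp (a * t))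
      (w t ^ 2 * Real.exp (a * t) * (2 * m t + a)) t := fun a t ht => by
    exact (((hw t ht).fun_pow 2).fun_mul (hE a t)).congr_deriv (by push_cast; ring)
  have hcont : ∀ a : ℝ, ContinuousOn (fun t => w t ^ 2 * Real.exp (a * t)) (Icc 0 Real.pi) :=
    fun a t ht => (hd a t ht).continuousAt.continuousWithinAt
  have hup : MonotoneOn (fun t => w t ^ 2 * Real.exp (2 * c * t)) (Icc 0 Real.pi) := by
    refine monotoneOn_of_deriv_nonneg (convex_Icc _ _) (hcont _) (fun t ht =>
      (hd _ t (interior_subset ht)).differentiableAt.differentiableWithinAt) fun t ht => ?_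
    rw [(hd _ t (interior_subset ht)).deriv]
    have := neg_le_of_abs_le (hm t (interior_subset ht))
    exact mul_nonneg (by positivity) (by linarith)
  have hdown : AntitoneOn (fun t => w t ^ 2 * Real.exp (-(2 * c) * t)) (Icc 0 Real.pi) := by
    refine antitoneOn_of_deriv_nonpos (convex_Icc _ _) (hcont _) (fun t ht =>
      (hd _ t (interior_subset ht)).differentiableAt.differentiableWithinAt) fun t ht => ?_
    rw [(hd _ t (interior_subset ht)).deriv]
    have := le_of_abs_le (hm t (interior_subset ht))
    exact mul_nonpos_of_nonneg_of_nonpos (by positivity) (by linarith)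
  have h00 : (0 : ℝ) ∈ Icc 0 Real.pi := ⟨le_rfl, Real.pi_pos.le⟩
  have hlow : ∀ t ∈ Icc 0 Real.pi, Real.exp (-(c * Real.pi)) ^ 2 ≤ w t ^ 2 := fun t ht => by
    have h1 := hup h00 ht ht.1
    simp only [h0, mul_zero, Real.exp_zero] at h1
    have h2 : Real.exp (2 * c * t) ≤ Real.exp (c * Real.pi) ^ 2 := by
      rw [← Real.exp_nat_mul]; apply Real.exp_le_exp.2
      push_cast; nlinarith [mul_le_mul_of_nonneg_left ht.2 hc]
    have h3 : 1 ≤ w t ^ 2 * Real.exp (c * Real.pi) ^ 2 := by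
      nlinarith [mul_le_mul_of_nonneg_left h2 (sq_nonneg (w t))]
    rw [Real.exp_neg, inv_pow, inv_le_iff_one_le_mul₀ (by positivity)]
    exact h3
  have hhigh : ∀ t ∈ Icc 0 Real.pi, w t ^ 2 ≤ Real.exp (c * Real.pi) ^ 2 := fun t ht => by
    have h1 := hdown h00 ht ht.1
    simp only [h0, mul_zero, Real.exp_zero] at h1
    have h2 : Real.exp (2 * c * t) ≤ Real.exp (c * Real.pi) ^ 2 := by
      rw [← Real.exp_nat_mul]; apply Real.exp_le_exp.2
      push_cast; nlinarith [mul_le_mul_of_nonneg_left ht.2 hc]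
    rw [neg_mul, Real.exp_neg, ← div_eq_mul_inv, div_le_iff₀ (Real.exp_pos _)] at h1
    linarith
  have hpos : ∀ t ∈ Icc 0 Real.pi, 0 < w t := fun t ht => by
    by_contra! hneg
    have hsub : Icc 0 t ⊆ Icc 0 Real.pi := Icc_subset_Icc_right ht.2
    obtain ⟨τ, hτ, hz⟩ := intermediate_value_Icc' ht.1
      (fun x hx => (hw x (hsub hx)).continuousAt.continuousWithinAt)
      (show (0 : ℝ) ∈ Icc (w t) (w 0) from ⟨hneg, by rw [h0]; exact zero_le_one⟩)
    have := hlow τ (hsub hτ)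
    rw [hz] at this
    have := Real.exp_pos (-(c * Real.pi))
    nlinarith [sq_pos_of_pos this]
  exact fun t ht => ⟨
    (sq_le_sq₀ (Real.exp_pos _).le (hpos t ht).le).1 (hlow t ht),
    (sq_le_sq₀ (hpos t ht).le (Real.exp_pos _).le).1 (hhigh t ht)⟩

/-- A continuous function off the origin is bounded on a quasi-homogeneous annulus. -/
theorem exists_abs_le_annulus {F : ℝ → ℝ → ℝ → ℝ} {k K : ℝ} (hk : 0 < k)
    (hF : ContinuousOn (fun q : ℝ × ℝ × ℝ => F q.1 q.2.1 q.2.2) (univ ×ˢ {0}ᶜ)) :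
    ∃ M > 0, ∀ ε ∈ Icc (-1 : ℝ) 1, ∀ w ∈ Icc k K, ∀ t ∈ Icc 0 Real.pi,
      |F ε (w * Real.sin t) (w ^ 2 * Real.cos t)| ≤ M := by
  have hcomp : IsCompact (Icc (-1 : ℝ) 1 ×ˢ (Icc k K ×ˢ Icc 0 Real.pi)) :=
    isCompact_Icc.prod (isCompact_Icc.prod isCompact_Icc)
  obtain ⟨M, hM⟩ := hcomp.exists_bound_of_continuousOn
    (f := fun q : ℝ × ℝ × ℝ => F q.1 (q.2.1 * Real.sin q.2.2) (q.2.1 ^ 2 * Real.cos q.2.2))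
    (hF.comp (f := fun q : ℝ × ℝ × ℝ => (q.1, q.2.1 * Real.sin q.2.2, q.2.1 ^ 2 * Real.cos q.2.2))
      (by fun_prop) fun q hq => ⟨mem_univ _, fun h => by
        have hw : 0 < q.2.1 := hk.trans_le hq.2.1.1
        have h1 : q.2.1 * Real.sin q.2.2 = 0 := congrArg Prod.fst h
        have h2 : q.2.1 ^ 2 * Real.cos q.2.2 = 0 := congrArg Prod.snd h
        have h3 := (mul_eq_zero.1 h1).resolve_left hw.ne'
        have h4 := (mul_eq_zero.1 h2).resolve_left (by positivity)
        have := Real.sin_sq_add_cos_sq q.2.2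
        rw [h3, h4] at this
        norm_num at this⟩)
  exact ⟨max M 1, by positivity, fun ε hε w hw t ht =>
    (hM (ε, w, t) ⟨hε, hw, ht⟩).trans (le_max_left _ _)⟩

/-- A positive continuous function off the origin is bounded below on a quasi-homogeneous
annulus. -/
theorem exists_le_annulus {G : ℝ → ℝ → ℝ} {k K : ℝ} (hk : 0 < k)
    (hG : ContinuousOn (fun z : ℝ × ℝ => G z.1 z.2) {0}ᶜ)
    (hpos : ∀ X Y : ℝ, (X, Y) ≠ 0 → 0 < G X Y) :
    ∃ m > 0, ∀ w ∈ Icc k K, ∀ t ∈ Icc 0 Real.pi,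
      m ≤ G (w * Real.sin t) (w ^ 2 * Real.cos t) := by
  have hne : ∀ w ∈ Icc k K, ∀ t, ((w * Real.sin t, w ^ 2 * Real.cos t) : ℝ × ℝ) ≠ 0 := by
    intro w hw t h
    have hw : 0 < w := hk.trans_le hw.1
    have h3 := (mul_eq_zero.1 (congrArg Prod.fst h)).resolve_left hw.ne'
    have h4 := (mul_eq_zero.1 (congrArg Prod.snd h)).resolve_left (by positivity)
    have := Real.sin_sq_add_cos_sq t
    rw [h3, h4] at this
    norm_num at this
  obtain ⟨M, hM, hb⟩ := exists_abs_le_annulus (F := fun _ X Y => (G X Y)⁻¹) (K := K) hk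
    ((hG.inv₀ fun z hz => (hpos z.1 z.2 hz).ne').comp (f := fun q : ℝ × ℝ × ℝ => q.2)
      (by fun_prop) fun q hq => hq.2)
  refine ⟨M⁻¹, by positivity, fun w hw t ht => ?_⟩
  have h := (le_abs_self _).trans (hb 0 (by norm_num) w hw t ht)
  exact inv_le_of_inv_le₀ (hpos _ _ (hne w hw t)) h

/-- First component of the rescaled vector field. -/
def scaledP (p : ℝ × ℝ × ℝ) (ε X Y : ℝ) : ℝ :=
  -Y + p.1 * X ^ 2 + p.2.1 * ε * X * Y + p.2.2 * ε ^ 2 * Y ^ 2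

/-- Second component of the rescaled vector field. -/
def scaledQ (ε X Y : ℝ) : ℝ := X ^ 3 + ε ^ 2 * X * Y ^ 2 + ε ^ 3 * Y ^ 3

theorem mul_sin_cos_ne_zero {w : ℝ} (hw : 0 < w) (t : ℝ) :
    ((w * Real.sin t, w ^ 2 * Real.cos t) : ℝ × ℝ) ≠ 0 := by
  intro h
  have h3 := (mul_eq_zero.1 (congrArg Prod.fst h)).resolve_left hw.ne'
  have h4 := (mul_eq_zero.1 (congrArg Prod.snd h)).resolve_left (by positivity)
  have := Real.sin_sq_add_cos_sq t
  rw [h3, h4] at this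
  norm_num at this

/-- Uniform bounds for the rescaled radius and the time change along short half turns. -/
theorem exists_uniform_bounds {p : ℝ × ℝ × ℝ} (hp : p.1 ^ 2 < 2) :
    ∃ η > 0, ∃ k > 0, ∃ K > 0, ∃ a > 0, ∃ b > 0, ∀ ε : ℝ, ε ≠ 0 → ∀ R : ℝ → ℝ, R 0 = ε →
      IsHalfTurn p η R → ∃ w μ : ℝ → ℝ, w 0 = 1 ∧ (∀ t, R t = ε * w t) ∧
        ∀ t ∈ Icc 0 Real.pi, w t ∈ Icc k K ∧ μ t ∈ Icc a b ∧
          HasDerivAt (fun t => w t * Real.sin t)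
            (-μ t * scaledP p ε (w t * Real.sin t) (w t ^ 2 * Real.cos t)) t ∧
          HasDerivAt (fun t => w t ^ 2 * Real.cos t)
            (-μ t * scaledQ ε (w t * Real.sin t) (w t ^ 2 * Real.cos t)) t := by
  obtain ⟨m, hm, η₀, hη₀, hΔ⟩ := exists_polarDelta_ge hp
  replace hΔ := hΔ.self_of_nhds
  have hcomp : IsCompact (Icc (-1 : ℝ) 1 ×ˢ Icc 0 Real.pi) := isCompact_Icc.prod isCompact_Icc
  obtain ⟨N, hN⟩ := hcomp.exists_bound_of_continuousOn
    (f := fun q : ℝ × ℝ => polarNum p q.1 (Real.sin q.2) (Real.cos q.2))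
    (by unfold polarNum polarP polarQ; fun_prop)
  obtain ⟨M, hM⟩ := hcomp.exists_bound_of_continuousOn
    (f := fun q : ℝ × ℝ => polarDelta p q.1 (Real.sin q.2) (Real.cos q.2))
    (by unfold polarDelta polarP polarQ; fun_prop)
  have hN0 : 0 ≤ N := (norm_nonneg _).trans (hN (0, 0) ⟨by simp, by simp [Real.pi_pos.le]⟩)
  have hM0 : 0 ≤ M := (norm_nonneg _).trans (hM (0, 0) ⟨by simp, by simp [Real.pi_pos.le]⟩)
  set K := Real.exp (N / m * Real.pi) with hK
  set k := Real.exp (-(N / m * Real.pi)) with hk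
  have hKpos : 0 < K := Real.exp_pos _
  have hkpos : 0 < k := Real.exp_pos _
  refine ⟨min (η₀ / 2) 1, by positivity, k, hkpos, K, hKpos, 1 / (K * (M + 1)), by positivity,
    2 / (k * m), by positivity, fun ε hε R hR0 hR => ?_⟩
  set w : ℝ → ℝ := fun t => R t / ε with hw
  have hRw : ∀ t, R t = ε * w t := fun t => by simp only [hw]; field_simp
  have hw0 : w 0 = 1 := by simp only [hw, hR0]; field_simp
  set Δ : ℝ → ℝ := fun t => polarDelta p (R t) (Real.sin t) (Real.cos t) with hΔdef
  have hsmall : ∀ t ∈ Icc 0 Real.pi, |R t| < η₀ ∧ R t ∈ Icc (-1 : ℝ) 1 := fun t ht => by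
    have h1 := (hR t ht).2
    exact ⟨by linarith [h1.trans (min_le_left _ _)], abs_le.1 (h1.trans (min_le_right _ _))⟩
  have hΔm : ∀ t ∈ Icc 0 Real.pi, m ≤ Δ t := fun t ht =>
    hΔ _ (hsmall t ht).1 _ _ (Real.sin_sq_add_cos_sq t)
  have hΔM : ∀ t ∈ Icc 0 Real.pi, Δ t ≤ M := fun t ht =>
    (le_abs_self _).trans (hM (R t, t) ⟨(hsmall t ht).2, ht⟩)
  have hwd : ∀ t ∈ Icc 0 Real.pi, HasDerivAt w (w t * polarM p (R t) t) t := fun t ht => by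
    exact (((hR t ht).1).div_const ε).congr_deriv (by simp only [hw]; ring)
  have hwb := exists_halfTurn_bounds (c := N / m) (by positivity) hw0 hwd fun t ht => by
    rw [polarM, abs_div, abs_neg]
    have h1 : |polarNum p (R t) (Real.sin t) (Real.cos t)| ≤ N :=
      hN (R t, t) ⟨(hsmall t ht).2, ht⟩
    have h2 : m ≤ |polarDelta p (R t) (Real.sin t) (Real.cos t)| :=
      (hΔm t ht).trans (le_abs_self _)
    gcongr
  refine ⟨w, fun t => (1 + Real.cos t ^ 2) / (w t * Δ t), hw0, hRw, fun t ht => ?_⟩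
  have hwt := hwb t ht
  have hwpos : 0 < w t := hkpos.trans_le hwt.1
  have hΔpos : 0 < Δ t := hm.trans_le (hΔm t ht)
  have hsc := Real.sin_sq_add_cos_sq t
  have hM' : polarM p (R t) t = -polarNum p (R t) (Real.sin t) (Real.cos t) / Δ t := rfl
  have hs2 : Real.sin t ^ 2 = 1 - Real.cos t ^ 2 := by linarith
  have hΔe : Δ t = polarDelta p (R t) (Real.sin t) (Real.cos t) := rfl
  refine ⟨hwt, ⟨?_, ?_⟩, ?_, ?_⟩
  · have h1 : w t * Δ t ≤ K * (M + 1) :=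
      mul_le_mul hwt.2 ((hΔM t ht).trans (by linarith)) hΔpos.le hKpos.le
    exact div_le_div₀ (by positivity) (by nlinarith [sq_nonneg (Real.cos t)]) (by positivity) h1
  · have h1 : k * m ≤ w t * Δ t := mul_le_mul hwt.1 (hΔm t ht) hm.le hwpos.le
    exact div_le_div₀ (by norm_num) (by nlinarith [sq_nonneg (Real.sin t)]) (by positivity) h1
  · refine ((hwd t ht).fun_mul (Real.hasDerivAt_sin t)).congr_deriv ?_
    have e : scaledP p ε (w t * Real.sin t) (w t ^ 2 * Real.cos t)
        = w t ^ 2 * polarP p (R t) (Real.sin t) (Real.cos t) := by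
      rw [hRw, scaledP, polarP]; ring
    rw [e, hM']
    field_simp
    rw [hΔe, polarDelta, polarNum]
    linear_combination (-polarP p (R t) (Real.sin t) (Real.cos t)) * hsc
  · refine (((hwd t ht).fun_pow 2).fun_mul (Real.hasDerivAt_cos t)).congr_deriv ?_
    have e : scaledQ ε (w t * Real.sin t) (w t ^ 2 * Real.cos t)
        = w t ^ 3 * polarQ (R t) (Real.sin t) (Real.cos t) := by
      rw [hRw, scaledQ, polarQ]; ring
    rw [e, hM']
    field_simp
    rw [hΔe, polarDelta, polarNum]
    linear_combination (-w t * polarQ (R t) (Real.sin t) (Real.cos t)) * hsc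

/-- Decrease of a Lyapunov function along a half turn. -/
theorem sub_le_of_lyapunov {u μ F E : ℝ → ℝ} {ε a b κ M : ℝ} (j : ℕ) (ha : 0 < a) (hκ : 0 < κ)
    (hu : ∀ t ∈ Icc 0 Real.pi, HasDerivAt u (-μ t * (F t + ε * E t)) t)
    (hμ : ∀ t ∈ Icc 0 Real.pi, μ t ∈ Icc a b)
    (hF : ∀ t ∈ Icc 0 Real.pi, κ * Real.sin t ^ j ≤ F t)
    (hE : ∀ t ∈ Icc 0 Real.pi, |E t| ≤ M) :
    u Real.pi - u 0 ≤ -(a * κ * ∫ x in (0 : ℝ)..Real.pi, Real.sin x ^ j) +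
        b * M * |ε| * Real.pi := by
  set I : ℝ → ℝ := fun t => ∫ x in (0 : ℝ)..t, Real.sin x ^ j with hI
  have hId : ∀ t, HasDerivAt I (Real.sin t ^ j) t := fun t =>
    (by fun_prop : Continuous fun x => Real.sin x ^ j).integral_hasStrictDerivAt 0 t |>.hasDerivAt
  set q : ℝ → ℝ := fun t => u t + (a * κ * I t - b * M * |ε| * t) with hq
  have hqd : ∀ t ∈ Icc 0 Real.pi, HasDerivAt q (-μ t * (F t + ε * E t)
      + (a * κ * Real.sin t ^ j - b * M * |ε|)) t := fun t ht => by
    refine (hu t ht).fun_add (((hId t).const_mul _).fun_sub ?_)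
    simpa using (hasDerivAt_id t).const_mul (b * M * |ε|)
  have hanti : AntitoneOn q (Icc 0 Real.pi) := by
    refine antitoneOn_of_deriv_nonpos (convex_Icc _ _)
      (fun t ht => (hqd t ht).continuousAt.continuousWithinAt) (fun t ht =>
      (hqd t (interior_subset ht)).differentiableAt.differentiableWithinAt) fun t ht => ?_
    replace ht := interior_subset ht
    rw [(hqd t ht).deriv]
    have h0 : 0 ≤ κ * Real.sin t ^ j :=
      mul_nonneg hκ.le (pow_nonneg (Real.sin_nonneg_of_nonneg_of_le_pi ht.1 ht.2) _)
    have h1 : a * (κ * Real.sin t ^ j) ≤ μ t * F t :=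
      mul_le_mul (hμ t ht).1 (hF t ht) h0 (ha.le.trans (hμ t ht).1)
    have h2 : |μ t * (ε * E t)| ≤ b * (|ε| * M) := by
      rw [abs_mul, abs_mul, abs_of_pos (ha.trans_le (hμ t ht).1)]
      exact mul_le_mul (hμ t ht).2 (mul_le_mul_of_nonneg_left (hE t ht) (abs_nonneg _))
        (by positivity) (ha.le.trans ((hμ t ht).1.trans (hμ t ht).2))
    have h3 := neg_le_of_abs_le h2
    nlinarith
  have := hanti (left_mem_Icc.2 Real.pi_pos.le) (right_mem_Icc.2 Real.pi_pos.le) Real.pi_pos.le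
  simp only [hq, hI, intervalIntegral.integral_same] at this
  linarith

/-- A Lyapunov function whose derivative has a sign at odd order forces a return gap. -/
theorem hasReturnGap_of_lyapunov {p : ℝ × ℝ × ℝ} (hp : p.1 ^ 2 < 2) {n : ℕ} (hn : Odd n)
    (hn7 : n ≤ 7) {L Lx Ly E : ℝ → ℝ → ℝ → ℝ} {G : ℝ → ℝ → ℝ} (j : ℕ)
    (hL : ∀ (ε : ℝ) {X Y : ℝ → ℝ} {X' Y' t : ℝ}, HasDerivAt X X' t → HasDerivAt Y Y' t →
      (X t, Y t) ≠ 0 → HasDerivAt (fun τ => L ε (X τ) (Y τ))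
        (Lx ε (X t) (Y t) * X' + Ly ε (X t) (Y t) * Y') t)
    (hLy : ContinuousOn (fun q : ℝ × ℝ × ℝ => Ly q.1 q.2.1 q.2.2) (univ ×ˢ {0}ᶜ))
    (heven : ∀ ε y, L (-ε) 0 y = L ε 0 y)
    (hG : ContinuousOn (fun z : ℝ × ℝ => G z.1 z.2) {0}ᶜ)
    (hGpos : ∀ X Y : ℝ, (X, Y) ≠ 0 → 0 < G X Y)
    (hE : ContinuousOn (fun q : ℝ × ℝ × ℝ => E q.1 q.2.1 q.2.2) (univ ×ˢ {0}ᶜ))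
    (hid : ∀ ε X Y : ℝ, (X, Y) ≠ 0 → scaledP p ε X Y * Lx ε X Y + scaledQ ε X Y * Ly ε X Y
      = ε ^ n * (X ^ (2 * j) * G X Y + ε * E ε X Y)) : HasReturnGap p := by
  obtain ⟨η, hη, k, hk, K, hK, a, ha, b, hb, H⟩ := exists_uniform_bounds hp
  obtain ⟨g, hg, hgb⟩ := exists_le_annulus (K := K) hk hG hGpos
  obtain ⟨M, hM, hMb⟩ := exists_abs_le_annulus (K := K) hk hE
  obtain ⟨N, hN, hNb⟩ := exists_abs_le_annulus (K := K) hk hLy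
  set I := ∫ x in (0 : ℝ)..Real.pi, Real.sin x ^ (2 * j) with hI
  have hIpos : 0 < I := integral_sin_pow_pos _
  set κ := k ^ (2 * j) * g with hκ
  have hκpos : 0 < κ := by positivity
  set c := a * κ * I / 2 with hc
  have hcpos : 0 < c := by positivity
  have hpi := Real.pi_pos
  have key : ∀ ε : ℝ, ε ≠ 0 → |ε| ≤ 1 → b * M * |ε| * Real.pi ≤ c → ∀ R : ℝ → ℝ, R 0 = ε →
      IsHalfTurn p η R → ∃ w ∈ Icc k K, R Real.pi = ε * w ∧
        (L ε 0 (-w ^ 2) - L ε 0 1) / ε ^ n ≤ -c := by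
    intro ε hε hε1 hεc R hR0 hR
    obtain ⟨w, μ, hw0, hRw, hw⟩ := H ε hε R hR0 hR
    have hpimem : Real.pi ∈ Icc 0 Real.pi := right_mem_Icc.2 hpi.le
    refine ⟨w Real.pi, (hw _ hpimem).1, hRw _, ?_⟩
    have h := sub_le_of_lyapunov
      (u := fun t => L ε (w t * Real.sin t) (w t ^ 2 * Real.cos t) / ε ^ n) (μ := μ)
      (F := fun t => (w t * Real.sin t) ^ (2 * j) * G (w t * Real.sin t) (w t ^ 2 * Real.cos t))
      (E := fun t => E ε (w t * Real.sin t) (w t ^ 2 * Real.cos t)) (ε := ε) (2 * j)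
      ha hκpos (fun t ht => ?_) (fun t ht => (hw t ht).2.1) (fun t ht => ?_)
      fun t ht => hMb ε (abs_le.1 hε1) _ (hw t ht).1 t ht
    · simp only [Real.sin_pi, Real.cos_pi, Real.sin_zero, Real.cos_zero, hw0, mul_zero, one_pow,
        mul_one, mul_neg] at h
      rw [sub_div]
      linarith
    · obtain ⟨h1, h2, h3, h4⟩ := hw t ht
      have hne := mul_sin_cos_ne_zero (hk.trans_le h1.1) t
      refine ((hL ε h3 h4 hne).div_const (ε ^ n)).congr_deriv ?_
      rw [div_eq_iff (pow_ne_zero _ hε)]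
      linear_combination (-μ t) * hid ε _ _ hne
    · have h1 := (hw t ht).1
      have hs := Real.sin_nonneg_of_nonneg_of_le_pi ht.1 ht.2
      calc κ * Real.sin t ^ (2 * j) = k ^ (2 * j) * Real.sin t ^ (2 * j) * g := by rw [hκ]; ring
        _ ≤ w t ^ (2 * j) * Real.sin t ^ (2 * j) * G (w t * Real.sin t) (w t ^ 2 * Real.cos t) := by
          have h2 := h1.1
          have h3 := hk.le.trans h2
          have := hgb (w t) h1 t ht
          gcongr
        _ = _ := by rw [mul_pow]
  refine ⟨η, hη, c / (N * K), by positivity, ?_⟩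
  have hsmall : ∀ᶠ ρ in 𝓝 (0 : ℝ), |ρ| < 1 ∧ b * M * |ρ| * Real.pi < c := by
    refine Eventually.and ?_ ?_
    · exact (continuous_abs.tendsto' 0 0 abs_zero).eventually_lt_const one_pos
    · exact ((by fun_prop : Continuous fun ρ : ℝ => b * M * |ρ| * Real.pi).tendsto' 0 0
        (by simp)).eventually_lt_const hcpos
  filter_upwards [hsmall.filter_mono nhdsWithin_le_nhds, self_mem_nhdsWithin] with ρ hρ hρ0 R₁ R₂
    h₁ h₂ hR₁ hR₂
  replace hρ0 : 0 < ρ := hρ0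
  obtain ⟨w₁, hw₁, e₁, d₁⟩ := key ρ hρ0.ne' hρ.1.le hρ.2.le R₁ h₁ hR₁
  obtain ⟨w₂, hw₂, e₂, d₂⟩ := key (-ρ) (neg_ne_zero.2 hρ0.ne') (by rw [abs_neg]; exact hρ.1.le)
    (by rw [abs_neg]; exact hρ.2.le) R₂ h₂ hR₂
  rw [heven, heven, hn.neg_pow, div_neg] at d₂
  have hρn : 0 < ρ ^ n := by positivity
  have d₁' := (div_le_iff₀ hρn).1 d₁
  have d₂' := (le_div_iff₀ hρn).1 (neg_le_neg_iff.1 d₂)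
  have hlip : |L ρ 0 (-w₂ ^ 2) - L ρ 0 (-w₁ ^ 2)| ≤ N * |-w₂ ^ 2 - -w₁ ^ 2| := by
    refine Convex.norm_image_sub_le_of_norm_hasDerivWithin_le (f := fun y => L ρ 0 y)
      (f' := fun y => Ly ρ 0 y) (s := Icc (-K ^ 2) (-k ^ 2)) (fun y hy => ?_) (fun y hy => ?_)
      (convex_Icc _ _) ?_ ?_
    · have hy0 : y < 0 := hy.2.trans_lt (neg_lt_zero.2 (pow_pos hk 2))
      have := hL ρ (hasDerivAt_const y (0 : ℝ)) (hasDerivAt_id y)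
        (fun h => hy0.ne (congrArg Prod.snd h))
      simpa using this.hasDerivWithinAt
    · have hy0 : y < 0 := hy.2.trans_lt (neg_lt_zero.2 (pow_pos hk 2))
      have := hNb ρ (abs_le.1 hρ.1.le) (√(-y)) ⟨Real.le_sqrt_of_sq_le (by linarith [hy.2]),
        (Real.sqrt_le_iff).2 ⟨hK.le, by linarith [hy.1]⟩⟩ Real.pi (right_mem_Icc.2 hpi.le)
      rw [Real.sq_sqrt (by linarith)] at this
      simpa using this
    · exact ⟨neg_le_neg (pow_le_pow_left₀ (hk.le.trans hw₁.1) hw₁.2 _),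
        neg_le_neg (pow_le_pow_left₀ hk.le hw₁.1 _)⟩
    · exact ⟨neg_le_neg (pow_le_pow_left₀ (hk.le.trans hw₂.1) hw₂.2 _),
        neg_le_neg (pow_le_pow_left₀ hk.le hw₂.1 _)⟩
  have h1 : |-w₂ ^ 2 - -w₁ ^ 2| ≤ |w₁ - w₂| * (2 * K) := by
    rw [show -w₂ ^ 2 - -w₁ ^ 2 = (w₁ - w₂) * (w₁ + w₂) by ring, abs_mul]
    refine mul_le_mul_of_nonneg_left ?_ (abs_nonneg _)
    rw [abs_of_pos (by linarith [hw₁.1, hw₂.1])]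
    linarith [hw₁.2, hw₂.2]
  have h2 : 2 * c * ρ ^ n ≤ N * (|w₁ - w₂| * (2 * K)) :=
    calc 2 * c * ρ ^ n ≤ L ρ 0 (-w₂ ^ 2) - L ρ 0 (-w₁ ^ 2) := by linarith
      _ ≤ _ := le_abs_self _
      _ ≤ _ := hlip
      _ ≤ _ := mul_le_mul_of_nonneg_left h1 hN.le
  have h3 : ρ ^ 7 ≤ ρ ^ n := pow_le_pow_of_le_one hρ0.le ((le_abs_self _).trans hρ.1.le) hn7
  rw [e₁, e₂, show ρ * w₁ + -ρ * w₂ = ρ * (w₁ - w₂) by ring,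
      abs_mul, abs_of_pos hρ0, div_mul_eq_mul_div,
    div_le_iff₀ (by positivity)]
  nlinarith [mul_le_mul_of_nonneg_left h3 (mul_nonneg hcpos.le hρ0.le),
    mul_le_mul_of_nonneg_left h2 hρ0.le]

/-- A function on the punctured plane together with its continuous partial derivatives. -/
structure PlaneFun where
  /-- The function. -/
  toFun : ℝ → ℝ → ℝ
  /-- The partial derivative in the first variable. -/
  dx : ℝ → ℝ → ℝ
  /-- The partial derivative in the second variable. -/
  dy : ℝ → ℝ → ℝ
  hasDerivAt : ∀ {X Y : ℝ → ℝ} {X' Y' t : ℝ}, HasDerivAt X X' t → HasDerivAt Y Y' t →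
    (X t, Y t) ≠ 0 → HasDerivAt (fun τ => toFun (X τ) (Y τ))
      (dx (X t) (Y t) * X' + dy (X t) (Y t) * Y') t
  cont : ContinuousOn (fun z : ℝ × ℝ => toFun z.1 z.2) {0}ᶜ
  cont_dx : ContinuousOn (fun z : ℝ × ℝ => dx z.1 z.2) {0}ᶜ
  cont_dy : ContinuousOn (fun z : ℝ × ℝ => dy z.1 z.2) {0}ᶜ

/-- The polynomial `∑ᵢ lᵢ x ^ (d - 2 i) y ^ i`. -/
def polyVal : ℕ → List ℝ → ℝ → ℝ → ℝ
  | _, [], _, _ => 0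
  | d, c :: l, x, y => c * x ^ d + y * polyVal (d - 2) l x y

/-- The `x`-derivative of `polyVal`. -/
def polyDx : ℕ → List ℝ → ℝ → ℝ → ℝ
  | _, [], _, _ => 0
  | d, c :: l, x, y => c * (d * x ^ (d - 1)) + y * polyDx (d - 2) l x y

/-- The `y`-derivative of `polyVal`. -/
def polyDy : ℕ → List ℝ → ℝ → ℝ → ℝ
  | _, [], _, _ => 0
  | d, _ :: l, x, y => polyVal (d - 2) l x y + y * polyDy (d - 2) l x y

theorem hasDerivAt_polyVal {X Y : ℝ → ℝ} {X' Y' t : ℝ} (hX : HasDerivAt X X' t)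
    (hY : HasDerivAt Y Y' t) (l : List ℝ) : ∀ d : ℕ, HasDerivAt (fun τ => polyVal d l (X τ) (Y τ))
      (polyDx d l (X t) (Y t) * X' + polyDy d l (X t) (Y t) * Y') t := by
  induction l with
  | nil => intro d; simpa [polyVal, polyDx, polyDy] using hasDerivAt_const t (0 : ℝ)
  | cons c l ih =>
    intro d
    simp only [polyVal, polyDx, polyDy]
    exact (((hX.fun_pow d).const_mul c).fun_add (hY.fun_mul (ih (d - 2)))).congr_deriv (by ring)

theorem continuous_polyVal (l : List ℝ) :
    ∀ d : ℕ, Continuous fun z : ℝ × ℝ => polyVal d l z.1 z.2 := by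
  induction l with
  | nil => intro d; simpa only [polyVal] using continuous_const
  | cons c l ih => intro d; have := ih (d - 2); simp only [polyVal]; fun_prop

theorem continuous_polyDx (l : List ℝ) :
    ∀ d : ℕ, Continuous fun z : ℝ × ℝ => polyDx d l z.1 z.2 := by
  induction l with
  | nil => intro d; simpa only [polyDx] using continuous_const
  | cons c l ih => intro d; have := ih (d - 2); simp only [polyDx]; fun_prop

theorem continuous_polyDy (l : List ℝ) :
    ∀ d : ℕ, Continuous fun z : ℝ × ℝ => polyDy d l z.1 z.2 := by
  induction l with
  | nil => intro d; simpa only [polyDy] using continuous_const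
  | cons c l ih =>
    intro d
    have := ih (d - 2)
    have := continuous_polyVal l (d - 2)
    simp only [polyDy]; fun_prop

namespace PlaneFun

/-- `polyVal` as a `PlaneFun`. -/
def poly (d : ℕ) (l : List ℝ) : PlaneFun where
  toFun := polyVal d l
  dx := polyDx d l
  dy := polyDy d l
  hasDerivAt hX hY _ := hasDerivAt_polyVal hX hY l d
  cont := (continuous_polyVal l d).continuousOn
  cont_dx := (continuous_polyDx l d).continuousOn
  cont_dy := (continuous_polyDy l d).continuousOn

/-- The combination `f + g * h`. -/
def addMul (f g h : PlaneFun) : PlaneFun where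
  toFun X Y := f.toFun X Y + g.toFun X Y * h.toFun X Y
  dx X Y := f.dx X Y + (g.dx X Y * h.toFun X Y + g.toFun X Y * h.dx X Y)
  dy X Y := f.dy X Y + (g.dy X Y * h.toFun X Y + g.toFun X Y * h.dy X Y)
  hasDerivAt hX hY h0 := ((f.hasDerivAt hX hY h0).fun_add
    ((g.hasDerivAt hX hY h0).fun_mul (h.hasDerivAt hX hY h0))).congr_deriv (by ring)
  cont := f.cont.add (g.cont.mul h.cont)
  cont_dx := f.cont_dx.add ((g.cont_dx.mul h.cont).add (g.cont.mul h.cont_dx))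
  cont_dy := f.cont_dy.add ((g.cont_dy.mul h.cont).add (g.cont.mul h.cont_dy))

end PlaneFun

/-- The invariant quartic of the principal part. -/
def quartic (A X Y : ℝ) : ℝ := X ^ 4 - 2 * A * X ^ 2 * Y + 2 * Y ^ 2

theorem quartic_pos {A : ℝ} (hA : A ^ 2 < 2) {X Y : ℝ} (h : (X, Y) ≠ 0) : 0 < quartic A X Y := by
  have e : quartic A X Y = (X ^ 2 - A * Y) ^ 2 + (2 - A ^ 2) * Y ^ 2 := by rw [quartic]; ring
  rw [e]
  rcases eq_or_ne Y 0 with rfl | hY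
  · have : X ≠ 0 := fun hX => h (by rw [hX]; rfl)
    simp; positivity
  · have h1 : 0 < Y ^ 2 := by positivity
    nlinarith [sq_nonneg (X ^ 2 - A * Y), mul_pos (sub_pos.2 hA) h1]

theorem hasDerivAt_quartic (A : ℝ) {X Y : ℝ → ℝ} {X' Y' t : ℝ} (hX : HasDerivAt X X' t)
    (hY : HasDerivAt Y Y' t) : HasDerivAt (fun τ => quartic A (X τ) (Y τ))
      ((4 * X t ^ 3 - 4 * A * X t * Y t) * X' + (4 * Y t - 2 * A * X t ^ 2) * Y') t := by
  unfold quartic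
  exact (((hX.fun_pow 4).fun_sub (((hX.fun_pow 2).const_mul (2 * A)).fun_mul hY)).fun_add
    ((hY.fun_pow 2).const_mul 2)).congr_deriv (by push_cast; ring)

theorem continuousOn_div_quartic_pow {A : ℝ} (hA : A ^ 2 < 2) {f : ℝ × ℝ → ℝ} (hf : Continuous f)
    (m : ℕ) : ContinuousOn (fun z : ℝ × ℝ => f z / quartic A z.1 z.2 ^ m) {0}ᶜ :=
  hf.continuousOn.div (by unfold quartic; fun_prop) fun _ hz => (pow_pos (quartic_pos hA hz) m).ne'

theorem continuousOn_div_quartic {A : ℝ} (hA : A ^ 2 < 2) {f : ℝ × ℝ → ℝ} (hf : Continuous f) :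
    ContinuousOn (fun z : ℝ × ℝ => f z / quartic A z.1 z.2) {0}ᶜ :=
  hf.continuousOn.div (by unfold quartic; fun_prop) fun _ hz => (quartic_pos hA hz).ne'

/-- The point of the complex plane whose argument is the angular variable. -/
noncomputable def anglePoint (A X Y : ℝ) : ℂ :=
  ((X ^ 2 - A * Y : ℝ) : ℂ) + ((√(2 - A ^ 2) * Y : ℝ) : ℂ) * Complex.I

theorem normSq_anglePoint {A : ℝ} (hA : A ^ 2 < 2) (X Y : ℝ) :
    Complex.normSq (anglePoint A X Y) = quartic A X Y := by
  rw [anglePoint, Complex.normSq_add_mul_I, mul_pow, Real.sq_sqrt (by linarith), quartic]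
  ring

theorem anglePoint_mem_slitPlane {A : ℝ} (hA : A ^ 2 < 2) {X Y : ℝ} (h : (X, Y) ≠ 0) :
    anglePoint A X Y ∈ Complex.slitPlane := by
  rw [Complex.mem_slitPlane_iff]
  simp only [anglePoint, Complex.add_re, Complex.add_im, Complex.ofReal_re, Complex.ofReal_im,
    Complex.re_ofReal_mul, Complex.im_ofReal_mul, Complex.I_re, Complex.I_im]
  rcases eq_or_ne Y 0 with rfl | hY
  · have : X ≠ 0 := fun hX => h (by rw [hX]; rfl)
    left; simp; positivity
  · have : √(2 - A ^ 2) ≠ 0 := (Real.sqrt_pos.2 (by linarith)).ne'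
    right; simp [this, hY]

namespace PlaneFun

/-- The angular variable of the principal part. -/
noncomputable def angle (A : ℝ) (hA : A ^ 2 < 2) : PlaneFun where
  toFun X Y := (anglePoint A X Y).arg / √(2 - A ^ 2)
  dx X Y := -2 * X * Y / quartic A X Y
  dy X Y := X ^ 2 / quartic A X Y
  hasDerivAt {X Y X' Y' t} hX hY h0 := by
    have hβ : 0 < √(2 - A ^ 2) := Real.sqrt_pos.2 (by linarith)
    have hd := Complex.imCLM.hasFDerivAt.comp_hasDerivAt t
      (((((hX.fun_pow 2).fun_sub (hY.const_mul A)).ofReal_comp).fun_add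
        (((hY.const_mul √(2 - A ^ 2)).ofReal_comp).mul_const Complex.I)).clog_real
        (anglePoint_mem_slitPlane hA h0))
    refine (HasDerivAt.div_const (hd.congr_of_eventuallyEq (Eventually.of_forall fun τ => ?_))
      _).congr_deriv ?_
    · exact (Complex.log_im _).symm
    · have hD := quartic_pos hA h0
      change Complex.im (_ / anglePoint A (X t) (Y t)) / _ = _
      rw [Complex.div_im, normSq_anglePoint hA]
      simp only [anglePoint, Complex.add_re, Complex.add_im, Complex.ofReal_re, Complex.ofReal_im,
        Complex.re_ofReal_mul, Complex.im_ofReal_mul, Complex.I_re, Complex.I_im]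
      field_simp
      ring
  cont := by
    refine ContinuousOn.div_const (fun z hz => ?_) _
    exact ((Complex.continuousAt_arg (anglePoint_mem_slitPlane hA hz)).comp
      (f := fun z : ℝ × ℝ => anglePoint A z.1 z.2)
      (Continuous.continuousAt (by unfold anglePoint; fun_prop))).continuousWithinAt
  cont_dx := continuousOn_div_quartic hA (by fun_prop)
  cont_dy := continuousOn_div_quartic hA (by fun_prop)

/-- The first integral of the principal part. -/
noncomputable def firstIntegral (A : ℝ) (hA : A ^ 2 < 2) : PlaneFun where
  toFun X Y := Real.log (quartic A X Y) / 4 - A / 2 * (angle A hA).toFun X Y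
  dx X Y := X ^ 3 / quartic A X Y
  dy X Y := (Y - A * X ^ 2) / quartic A X Y
  hasDerivAt {X Y X' Y' t} hX hY h0 := by
    have hD := (quartic_pos hA h0).ne'
    have hd := hasDerivAt_quartic A hX hY
    refine (((hd.log hD).div_const 4).fun_sub
      (((angle A hA).hasDerivAt hX hY h0).const_mul (A / 2))).congr_deriv ?_
    simp only [angle]
    field_simp
    ring
  cont := by
    refine (ContinuousOn.div_const (ContinuousOn.log (by unfold quartic; fun_prop)
      fun z hz => (quartic_pos hA hz).ne') _).sub (continuousOn_const.mul (angle A hA).cont)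
  cont_dx := continuousOn_div_quartic hA (by fun_prop)
  cont_dy := continuousOn_div_quartic hA (by fun_prop)

end PlaneFun

/-- A polynomial divided by a power of the quartic, as a `PlaneFun`. -/
noncomputable def PlaneFun.overQuartic (A : ℝ) (hA : A ^ 2 < 2) (d : ℕ) (l : List ℝ) (m : ℕ) :
    PlaneFun where
  toFun X Y := polyVal d l X Y / quartic A X Y ^ m
  dx X Y := (polyDx d l X Y * quartic A X Y - m * polyVal d l X Y * (4 * X ^ 3 - 4 * A * X * Y))
    / quartic A X Y ^ (m + 1)
  dy X Y := (polyDy d l X Y * quartic A X Y - m * polyVal d l X Y * (4 * Y - 2 * A * X ^ 2))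
    / quartic A X Y ^ (m + 1)
  hasDerivAt {X Y X' Y' t} hX hY h0 := by
    have hne := (quartic_pos hA h0).ne'
    refine ((hasDerivAt_polyVal hX hY l d).fun_div ((hasDerivAt_quartic A hX hY).fun_pow m)
      (pow_ne_zero _ hne)).congr_deriv ?_
    cases m with
    | zero => simp; field_simp
    | succ m =>
      simp only [Nat.add_sub_cancel]
      field_simp
      ring
  cont := continuousOn_div_quartic_pow hA (continuous_polyVal l d) m
  cont_dx := by
    have := continuous_polyVal l d
    have := continuous_polyDx l d
    exact continuousOn_div_quartic_pow hA (by unfold quartic; fun_prop) _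
  cont_dy := by
    have := continuous_polyVal l d
    have := continuous_polyDy l d
    exact continuousOn_div_quartic_pow hA (by unfold quartic; fun_prop) _

/-- The coefficient of order `i` in the derivative of `∑ₖ ε ^ k h (k + 3)` along the
rescaled field. -/
def lieCoeff (p : ℝ × ℝ × ℝ) (h : ℕ → PlaneFun) (i : ℕ) (X Y : ℝ) : ℝ :=
  (-Y + p.1 * X ^ 2) * (h (i + 3)).dx X Y + X ^ 3 * (h (i + 3)).dy X Y
    + p.2.1 * X * Y * (h (i + 2)).dx X Y
    + (p.2.2 * Y ^ 2 * (h (i + 1)).dx X Y + X * Y ^ 2 * (h (i + 1)).dy X Y)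
    + Y ^ 3 * (h i).dy X Y

/-- The remainder in the derivative of `∑ₖ ε ^ k h (k + 3)`, `k < n`, along the rescaled field. -/
def lieRem (p : ℝ × ℝ × ℝ) (h : ℕ → PlaneFun) (n : ℕ) (ε X Y : ℝ) : ℝ :=
  p.2.1 * X * Y * (h (n + 2)).dx X Y
    + p.2.2 * Y ^ 2 * ((h (n + 1)).dx X Y + ε * (h (n + 2)).dx X Y)
    + X * Y ^ 2 * ((h (n + 1)).dy X Y + ε * (h (n + 2)).dy X Y)
    + Y ^ 3 * ((h n).dy X Y + ε * (h (n + 1)).dy X Y + ε ^ 2 * (h (n + 2)).dy X Y)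

theorem scaled_sum (p : ℝ × ℝ × ℝ) (h : ℕ → PlaneFun) (h0 : ∀ i < 3, h i = PlaneFun.poly 0 [])
    (ε X Y : ℝ) (n : ℕ) :
    scaledP p ε X Y * ∑ k ∈ Finset.range n, ε ^ k * (h (k + 3)).dx X Y
      + scaledQ ε X Y * ∑ k ∈ Finset.range n, ε ^ k * (h (k + 3)).dy X Y
      = ∑ k ∈ Finset.range n, ε ^ k * lieCoeff p h k X Y + ε ^ n * lieRem p h n ε X Y := by
  induction n with
  | zero => simp [lieRem, h0, PlaneFun.poly, polyDx, polyDy]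
  | succ n ih =>
    rw [Finset.sum_range_succ, Finset.sum_range_succ, Finset.sum_range_succ]
    simp only [scaledP, scaledQ, lieCoeff, lieRem] at ih ⊢
    linear_combination ih

/-- Formal Lyapunov series with a nonzero obstruction at odd order at most `7`. -/
theorem hasReturnGap_of_series {p : ℝ × ℝ × ℝ} (hp : p.1 ^ 2 < 2) {n : ℕ} (hn : Odd n) (hn7 : n ≤ 7)
    (h : ℕ → PlaneFun) (h0 : ∀ i < 3, h i = PlaneFun.poly 0 [])
    (hodd : ∀ k ≤ n, Odd k → ∀ y, (h (k + 3)).toFun 0 y = 0) {v : ℝ} (hv : v ≠ 0) (j : ℕ)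
    {G : ℝ → ℝ → ℝ} (hG : ContinuousOn (fun z : ℝ × ℝ => G z.1 z.2) {0}ᶜ)
    (hGpos : ∀ X Y : ℝ, (X, Y) ≠ 0 → 0 < G X Y)
    (hT : ∀ i < n, ∀ X Y : ℝ, (X, Y) ≠ 0 → lieCoeff p h i X Y = 0)
    (hTn : ∀ X Y : ℝ, (X, Y) ≠ 0 → lieCoeff p h n X Y = v * (X ^ (2 * j) * G X Y)) :
    HasReturnGap p := by
  have hx : ∀ i, ContinuousOn (fun q : ℝ × ℝ × ℝ => (h i).dx q.2.1 q.2.2) (univ ×ˢ {0}ᶜ) :=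
    fun i => (h i).cont_dx.comp (f := fun q : ℝ × ℝ × ℝ => q.2) (by fun_prop) fun q hq => hq.2
  have hy : ∀ i, ContinuousOn (fun q : ℝ × ℝ × ℝ => (h i).dy q.2.1 q.2.2) (univ ×ˢ {0}ᶜ) :=
    fun i => (h i).cont_dy.comp (f := fun q : ℝ × ℝ × ℝ => q.2) (by fun_prop) fun q hq => hq.2
  refine hasReturnGap_of_lyapunov hp hn hn7 (G := G) j
    (L := fun ε X Y => v⁻¹ * ∑ k ∈ Finset.range (n + 1), ε ^ k * (h (k + 3)).toFun X Y)
    (Lx := fun ε X Y => v⁻¹ * ∑ k ∈ Finset.range (n + 1), ε ^ k * (h (k + 3)).dx X Y)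
    (Ly := fun ε X Y => v⁻¹ * ∑ k ∈ Finset.range (n + 1), ε ^ k * (h (k + 3)).dy X Y)
    (E := fun ε X Y => v⁻¹ * lieRem p h (n + 1) ε X Y) ?_ ?_ ?_ hG hGpos ?_ ?_
  · intro ε X Y X' Y' t hX hY hne
    refine ((HasDerivAt.fun_sum fun k _ =>
      ((h (k + 3)).hasDerivAt hX hY hne).const_mul (ε ^ k)).const_mul v⁻¹).congr_deriv ?_
    rw [mul_assoc, mul_assoc, ← mul_add, Finset.sum_mul, Finset.sum_mul, ← Finset.sum_add_distrib]
    congr 1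
    exact Finset.sum_congr rfl fun k _ => by ring
  · exact continuousOn_const.mul (continuousOn_finsetSum _ fun k _ =>
      (by fun_prop : Continuous fun q : ℝ × ℝ × ℝ => q.1 ^ k).continuousOn.mul (hy _))
  · intro ε y
    refine congrArg (v⁻¹ * ·) (Finset.sum_congr rfl fun k hk => ?_)
    rcases Nat.even_or_odd k with hk' | hk'
    · rw [hk'.neg_pow]
    · rw [hodd k (by simpa [Nat.lt_succ_iff] using hk) hk', mul_zero, mul_zero]
  · have := hx (n + 1 + 2)
    have := hx (n + 1 + 1)
    have := hy (n + 1 + 2)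
    have := hy (n + 1 + 1)
    have := hy (n + 1)
    unfold lieRem
    fun_prop
  · intro ε X Y hne
    have := scaled_sum p h h0 ε X Y (n + 1)
    rw [Finset.sum_range_succ (fun k => ε ^ k * lieCoeff p h k X Y), hTn X Y hne,
      Finset.sum_eq_zero (f := fun k => ε ^ k * lieCoeff p h k X Y)
        fun k hk => by rw [hT k (Finset.mem_range.1 hk) X Y hne, mul_zero]] at this
    rw [mul_left_comm, mul_left_comm (scaledQ ε X Y), ← mul_add, this]
    field_simp
    ring

theorem hasReturnGap_of_ne_zero {p : ℝ × ℝ × ℝ} (hp : p.1 ^ 2 < 2) (hA : p.1 ≠ 0)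
    (hB : p.2.1 ≠ 0) : HasReturnGap p := by
  obtain ⟨A, B, C⟩ := p
  dsimp only at hp hA hB
  set h : ℕ → PlaneFun := fun
    | 3 => PlaneFun.firstIntegral A hp
    | 4 => PlaneFun.overQuartic A hp 5 [B / 5] 1
    | _ => PlaneFun.poly 0 [] with hh
  refine hasReturnGap_of_series hp (n := 1) (by decide) (by norm_num) h ?_ ?_
    (v := 3 * A * B / 5) (by positivity) 3 (G := fun X Y => 1 / quartic A X Y ^ 1)
    (continuousOn_div_quartic_pow hp continuous_const 1)
    (fun X Y h => by have := quartic_pos hp h; positivity) ?_ ?_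
  · intro i hi; interval_cases i <;> rfl
  · intro k hk hk' y
    interval_cases k
    · norm_num at hk'
    · simp [hh, PlaneFun.overQuartic, polyVal]
  · intro i hi X Y hne
    have := (quartic_pos hp hne).ne'
    interval_cases i
    simp only [lieCoeff, hh, PlaneFun.overQuartic, PlaneFun.poly, PlaneFun.firstIntegral, polyVal,
      polyDx, polyDy]
    field_simp
    ring
  · intro X Y hne
    have := (quartic_pos hp hne).ne'
    simp only [lieCoeff, hh, PlaneFun.overQuartic, PlaneFun.poly, PlaneFun.firstIntegral, polyVal,
      polyDx, polyDy]
    field_simp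
    simp only [quartic]
    push_cast
    ring

theorem hasReturnGap_of_eq_zero (B C : ℝ) : HasReturnGap (0, B, C) := by
  have hp : (0 : ℝ) ^ 2 < 2 := by norm_num
  set κ := 9 / 8 * B + 1 / 2 * B ^ 2 * C + 1 / 4 * C with hκ
  set h : ℕ → PlaneFun := fun
    | 3 => PlaneFun.poly 4 [1, 0, 2]
    | 4 => PlaneFun.poly 5 [4 / 5 * B]
    | 5 => PlaneFun.poly 6 [2 / 3 * (B ^ 2 + 1), 0, 2, -4 / 3 * C]
    | 6 => PlaneFun.poly 7 [4 / 7 * B ^ 3 + 20 / 21 * B, 12 / 5 + 4 / 5 * B * C, 4 / 3 * B, 4]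
    | 7 => PlaneFun.addMul (PlaneFun.poly 8 [1 / 2 * B ^ 4 + 13 / 12 * B ^ 2 + 1 / 4, κ,
        B ^ 2 + 1, -1 / 4 * B - B ^ 2 * C - 1 / 2 * C])
        (PlaneFun.poly 8 [-κ, 0, -4 * κ, 0, -4 * κ]) (PlaneFun.angle 0 hp)
    | 8 => PlaneFun.addMul (PlaneFun.poly 9 [
        4 / 9 * B ^ 5 + 154 / 135 * B ^ 3 + 14 / 27 * B + 8 / 15 * C + 8 / 45 * B * C ^ 2,
        47 / 35 * B ^ 2 + 32 / 35 * B ^ 3 * C + 38 / 21 * B * C + 92 / 35,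
        4 / 5 * B ^ 3 + 4 / 3 * B + 12 / 5 * C + 4 / 5 * B * C ^ 2,
        4 / 3 * B ^ 2 + 4 / 3 * B * C + 16 / 3])
        (PlaneFun.poly 9 [-8 / 5 * κ * B, 0, -16 / 5 * κ * B]) (PlaneFun.angle 0 hp)
    | _ => PlaneFun.poly 0 [] with hh
  have h0 : ∀ i < 3, h i = PlaneFun.poly 0 [] := fun i hi => by interval_cases i <;> rfl
  have hodd : ∀ k ≤ 5, Odd k → ∀ y, (h (k + 3)).toFun 0 y = 0 := by
    intro k hk hk' y
    interval_cases k
    all_goals first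
      | exact absurd hk' (by decide)
      | simp [hh, PlaneFun.poly, PlaneFun.addMul, polyVal]
  have hlow : ∀ i < 3, ∀ X Y, lieCoeff (0, B, C) h i X Y = 0 := by
    intro i hi X Y
    interval_cases i
    all_goals
      simp only [lieCoeff, hh, PlaneFun.poly, polyVal, polyDx, polyDy]
      push_cast
      ring
  have h3 : ∀ X Y, lieCoeff (0, B, C) h 3 X Y = 4 / 5 * (B * C + 3) * (X ^ (2 * 4) * 1) := by
    intro X Y
    simp only [lieCoeff, hh, PlaneFun.poly, polyVal, polyDx, polyDy]
    push_cast
    ring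
  have hψx : ∀ X Y : ℝ, (X, Y) ≠ 0 →
      (X ^ 4 + 2 * Y ^ 2) * (PlaneFun.angle 0 hp).dx X Y = -2 * X * Y := by
    intro X Y hne
    have := (quartic_pos hp hne).ne'
    simp only [PlaneFun.angle]
    field_simp
    rw [quartic]
    ring
  have hψ : ∀ X Y : ℝ, (X, Y) ≠ 0 →
      -Y * (PlaneFun.angle 0 hp).dx X Y + X ^ 3 * (PlaneFun.angle 0 hp).dy X Y = X := by
    intro X Y hne
    have := (quartic_pos hp hne).ne'
    simp only [PlaneFun.angle]
    field_simp
    rw [quartic]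
    ring
  by_cases hBC : B * C = -3
  · refine hasReturnGap_of_series hp (n := 5) (by decide) (by norm_num) h h0 hodd
      (v := -4 / 5 * (B ^ 2 + 2)) (by have : 0 < B ^ 2 + 2 := by positivity
                                      intro h; linarith) 5 (G := fun _ _ => 1)
      continuousOn_const (fun _ _ _ => one_pos) ?_ ?_
    · intro i hi X Y hne
      rcases lt_or_ge i 3 with hi3 | hi3
      · exact hlow i hi3 X Y
      interval_cases i
      · rw [h3, hBC]; ring
      · simp only [lieCoeff, hh, PlaneFun.poly, PlaneFun.addMul, polyVal, polyDx, polyDy]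
        push_cast
        linear_combination (-κ * (X ^ 4 + 2 * Y ^ 2) ^ 2) * hψ X Y hne
    · intro X Y hne
      simp only [lieCoeff, hh, PlaneFun.poly, PlaneFun.addMul, polyVal, polyDx, polyDy]
      push_cast
      linear_combination (-8 / 5 * κ * B * X ^ 5 * (X ^ 4 + 2 * Y ^ 2)) * hψ X Y hne
        - κ * B * X * Y * (X ^ 4 + 2 * Y ^ 2) * hψx X Y hne
        + (148 / 105 + 4 / 35 * B ^ 2) * X ^ 10 * hBC
  · exact hasReturnGap_of_series hp (n := 3) (by decide) (by norm_num) h h0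
      (fun k hk => hodd k (by omega)) (v := 4 / 5 * (B * C + 3))
      (mul_ne_zero (by norm_num) fun h => hBC (by linarith)) 4 (G := fun _ _ => 1)
      continuousOn_const (fun _ _ _ => one_pos) (fun i hi X Y _ => hlow i hi X Y)
          fun X Y _ => h3 X Y

/-- `lieCoeff` of quotients by powers of the quartic, over a common denominator. -/
theorem lieCoeff_overQuartic {A : ℝ} (hA : A ^ 2 < 2) (C : ℝ) {h : ℕ → PlaneFun} {i d₁ d₂ d₃ : ℕ}
    {l₁ l₂ l₃ : List ℝ} {m₂ m₃ e₂ e₃ m : ℕ} (h₂ : m = m₂ + 1 + e₂) (h₃ : m = m₃ + 1 + e₃)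
    (H₁ : h (i + 3) = PlaneFun.overQuartic A hA d₁ l₁ m)
    (H₂ : h (i + 1) = PlaneFun.overQuartic A hA d₂ l₂ m₂)
    (H₃ : h i = PlaneFun.overQuartic A hA d₃ l₃ m₃) {X Y : ℝ} (hne : (X, Y) ≠ 0) :
    lieCoeff (A, 0, C) h i X Y = ((-Y + A * X ^ 2) * polyDx d₁ l₁ X Y + X ^ 3 * polyDy d₁ l₁ X Y
      - 2 * m * A * X * polyVal d₁ l₁ X Y
      + quartic A X Y ^ e₂ * (quartic A X Y * (C * Y ^ 2 * polyDx d₂ l₂ X Y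
          + X * Y ^ 2 * polyDy d₂ l₂ X Y)
        - m₂ * polyVal d₂ l₂ X Y * (C * Y ^ 2 * (4 * X ^ 3 - 4 * A * X * Y)
          + X * Y ^ 2 * (4 * Y - 2 * A * X ^ 2)))
      + quartic A X Y ^ e₃ * (quartic A X Y * (Y ^ 3 * polyDy d₃ l₃ X Y)
        - m₃ * polyVal d₃ l₃ X Y * (Y ^ 3 * (4 * Y - 2 * A * X ^ 2)))) / quartic A X Y ^ m := by
  have hD := (quartic_pos hA hne).ne'
  have hX : (-Y + A * X ^ 2) * (4 * X ^ 3 - 4 * A * X * Y) + X ^ 3 * (4 * Y - 2 * A * X ^ 2)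
      = 2 * A * X * quartic A X Y := by rw [quartic]; ring
  have E₁ : (-Y + A * X ^ 2) * (h (i + 3)).dx X Y + X ^ 3 * (h (i + 3)).dy X Y
      = ((-Y + A * X ^ 2) * polyDx d₁ l₁ X Y + X ^ 3 * polyDy d₁ l₁ X Y
        - 2 * m * A * X * polyVal d₁ l₁ X Y) / quartic A X Y ^ m := by
    simp only [H₁, PlaneFun.overQuartic]
    field_simp
    linear_combination -m * quartic A X Y ^ m * polyVal d₁ l₁ X Y * hX
  have E₂ : C * Y ^ 2 * (h (i + 1)).dx X Y + X * Y ^ 2 * (h (i + 1)).dy X Y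
      = quartic A X Y ^ e₂ * (quartic A X Y * (C * Y ^ 2 * polyDx d₂ l₂ X Y
          + X * Y ^ 2 * polyDy d₂ l₂ X Y)
        - m₂ * polyVal d₂ l₂ X Y * (C * Y ^ 2 * (4 * X ^ 3 - 4 * A * X * Y)
          + X * Y ^ 2 * (4 * Y - 2 * A * X ^ 2))) / quartic A X Y ^ m := by
    rw [h₂, pow_add, mul_comm (quartic A X Y ^ (m₂ + 1)),
      mul_div_mul_left _ _ (pow_ne_zero _ hD)]
    simp only [H₂, PlaneFun.overQuartic]
    ring
  have E₃ : Y ^ 3 * (h i).dy X Y = quartic A X Y ^ e₃ * (quartic A X Y * (Y ^ 3 * polyDy d₃ l₃ X Y)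
        - m₃ * polyVal d₃ l₃ X Y * (Y ^ 3 * (4 * Y - 2 * A * X ^ 2))) / quartic A X Y ^ m := by
    rw [h₃, pow_add, mul_comm (quartic A X Y ^ (m₃ + 1)),
      mul_div_mul_left _ _ (pow_ne_zero _ hD)]
    simp only [H₃, PlaneFun.overQuartic]
    ring
  simp only [lieCoeff, E₁, E₂, E₃]
  ring

theorem lieCoeff_of_lt_three {A : ℝ} (hA : A ^ 2 < 2) {C κ : ℝ}
    (hκ : (18 - 8 * A ^ 2) * κ = 3 - 2 * A ^ 2 + 2 * A * C) {h : ℕ → PlaneFun}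
    (h0 : ∀ i < 3, h i = PlaneFun.poly 0 []) (h3 : h 3 = PlaneFun.firstIntegral A hA)
    (h4 : h 4 = PlaneFun.overQuartic A hA 0 [] 0)
    (h5 : h 5 = PlaneFun.overQuartic A hA 6
      [κ, -4 * A * κ, (3 + 4 * A ^ 2) * κ, (A - C - 16 * A * κ) / 3] 1)
    {i : ℕ} (hi : i < 3) {X Y : ℝ} (hne : (X, Y) ≠ 0) : lieCoeff (A, 0, C) h i X Y = 0 := by
  have := (quartic_pos hA hne).ne'
  interval_cases i
  all_goals
    simp only [lieCoeff, h0 0, h0 1, h0 2, h3, h4, h5, PlaneFun.overQuartic, PlaneFun.poly,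
      PlaneFun.firstIntegral, polyVal, polyDx, polyDy, Nat.reduceAdd, Nat.reduceLT]
    field_simp
    simp only [quartic]
    push_cast
  · ring
  · ring
  · linear_combination -X * Y ^ 3 * (X ^ 4 - 2 * A * X ^ 2 * Y + 2 * Y ^ 2) * hκ

theorem lieCoeff_three {A : ℝ} (hA : A ^ 2 < 2) (C : ℝ) {h : ℕ → PlaneFun}
    (h3 : h 3 = PlaneFun.firstIntegral A hA) (h4 : h 4 = PlaneFun.overQuartic A hA 0 [] 0)
    (h6 : h 6 = PlaneFun.overQuartic A hA 7
      [A / 15 - 2 * A ^ 3 / 35, (3 - 2 * A ^ 2 / 3) / 5, -2 * A / 3, 1] 1)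
    {X Y : ℝ} (hne : (X, Y) ≠ 0) : lieCoeff (A, 0, C) h 3 X Y
      = -(10 * A ^ 4 - 7 * A ^ 2 - 21) / 35 * (X ^ (2 * 4) * (1 / quartic A X Y ^ 1)) := by
  have := (quartic_pos hA hne).ne'
  simp only [lieCoeff, h3, h4, h6, PlaneFun.overQuartic, PlaneFun.firstIntegral, polyVal, polyDx,
    polyDy, Nat.reduceAdd]
  field_simp
  simp only [quartic]
  push_cast
  ring

theorem hasReturnGap_of_eq_zero_of_ne {A C : ℝ} (hA : A ^ 2 < 2)
    (hr : 10 * A ^ 4 - 7 * A ^ 2 - 21 ≠ 0) : HasReturnGap (A, 0, C) := by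
  obtain ⟨κ, hκ⟩ : ∃ κ : ℝ, (18 - 8 * A ^ 2) * κ = 3 - 2 * A ^ 2 + 2 * A * C :=
    ⟨(3 - 2 * A ^ 2 + 2 * A * C) / (18 - 8 * A ^ 2), mul_div_cancel₀ _ (by linarith)⟩
  set h : ℕ → PlaneFun := fun
    | 3 => PlaneFun.firstIntegral A hA
    | 4 => PlaneFun.overQuartic A hA 0 [] 0
    | 5 => PlaneFun.overQuartic A hA 6
        [κ, -4 * A * κ, (3 + 4 * A ^ 2) * κ, (A - C - 16 * A * κ) / 3] 1
    | 6 => PlaneFun.overQuartic A hA 7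
        [A / 15 - 2 * A ^ 3 / 35, (3 - 2 * A ^ 2 / 3) / 5, -2 * A / 3, 1] 1
    | _ => PlaneFun.poly 0 [] with hh
  have h0 : ∀ i < 3, h i = PlaneFun.poly 0 [] := fun i hi => by interval_cases i <;> rfl
  refine hasReturnGap_of_series hA (n := 3) (by decide) (by norm_num) h h0 ?_
    (div_ne_zero (neg_ne_zero.2 hr) (by norm_num)) 4
    (G := fun X Y => 1 / quartic A X Y ^ 1) (continuousOn_div_quartic_pow hA continuous_const 1)
    (fun X Y h => by have := quartic_pos hA h; positivity)
    (fun i hi X Y hne => lieCoeff_of_lt_three hA hκ h0 rfl rfl rfl hi hne)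
    (fun X Y hne => lieCoeff_three hA C rfl rfl rfl hne)
  intro k hk hk' y
  interval_cases k
  all_goals first
    | exact absurd hk' (by decide)
    | simp [hh, PlaneFun.overQuartic, polyVal]

/-- The numerator of order 4 of `resonantSeries`. -/
noncomputable def resonantNumFour (A C : ℝ) : List ℝ :=
  [694501 / 9298248 * C ^ 2 + 378985 / 4649124 * A ^ 2 * C ^ 2 + 26477 / 774854 * A * C - 51810 /
   2711989 * A ^ 3 * C + 20833 / 1549708 - 40275 / 1549708 * A ^ 2, -694501 / 1162281 * A * C ^ 2 -
   757970 / 1162281 * A ^ 3 * C ^ 2 + 124344 / 387427 * C - 64460 / 387427 * A ^ 2 * C - 41666 /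
   387427 * A + 80550 / 387427 * A ^ 3, 7061449 / 1549708 * C ^ 2 + 2829145 / 774854 * A ^ 2 * C ^
   2 - 293601 / 387427 * A * C + 1042800 / 2711989 * A ^ 3 * C - 952431 / 774854 - 209139 / 774854
   * A ^ 2, -9592853 / 1162281 * A * C ^ 2 - 8324470 / 1162281 * A ^ 3 * C ^ 2 + 253855 / 1162281 *
   C + 531524 / 1162281 * A ^ 2 * C + 1519615 / 1162281 * A + 1119068 / 1162281 * A ^ 3, 6737477 /
   387427 * C ^ 2 + 5713272 / 387427 * A ^ 2 * C ^ 2 - 2836159 / 1162281 * A * C - 5132144 /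
   8135967 * A ^ 3 * C - 22641341 / 7748540 - 2624523 / 1937135 * A ^ 2, -4201532 / 387427 * A * C
   ^ 2 - 3664860 / 387427 * A ^ 3 * C ^ 2 + 1274294 / 387427 * C + 1159188 / 387427 * A ^ 2 * C +
   398426 / 387427 * A + 267526 / 387427 * A ^ 3, 2100766 / 387427 * C ^ 2 + 1832430 / 387427 * A ^
   2 * C ^ 2 - 2096380 / 1162281 * A * C - 8989220 / 8135967 * A ^ 3 * C - 1059155 / 2324562 +
   17551 / 1162281 * A ^ 2]

/-- The numerator of order 5 of `resonantSeries`. -/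
noncomputable def resonantNumFive (A C : ℝ) : List ℝ :=
  [-191 / 26455 * C - 12403 / 185185 * A ^ 2 * C + 94967 / 2777775 * A + 12367 / 8333325 * A ^ 3,
   7338 / 14245 * A * C + 2914 / 42735 * A ^ 3 * C + 148409 / 641025 - 485941 / 1923075 * A ^ 2,
   -507 / 925 * C - 46724 / 19425 * A ^ 2 * C - 34271 / 58275 * A + 156304 / 174825 * A ^ 3, 10628
   / 3885 * A * C + 16768 / 3885 * A ^ 3 * C - 15542 / 6475 - 6234 / 6475 * A ^ 2, -1534 / 185 * C
   - 1744 / 185 * A ^ 2 * C + 166 / 185 * A + 1448 / 555 * A ^ 3, 574 / 111 * A * C + 800 / 111 * A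
   ^ 3 * C - 162 / 37 - 230 / 111 * A ^ 2, -100 / 37 * C - 160 / 37 * A ^ 2 * C + 26 / 111 * A +
   160 / 111 * A ^ 3]

/-- The numerator of order 6 of `resonantSeries`. -/
noncomputable def resonantNumSix (A C : ℝ) : List ℝ :=
  [-1525558329943 / 202187150697762 * A * C ^ 3 - 101914578055 / 101093575348881 * A ^ 3 * C ^ 3 +
   922057412009 / 44930477932836 * C ^ 2 + 308545276305 / 7488412988806 * A ^ 2 * C ^ 2 +
   210709644122 / 33697858449627 * A * C - 4630100876645 / 235885009147389 * A ^ 3 * C -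
   237284683864667 / 42122323062033750 + 841053581666266 / 147428130717118125 * A ^ 2, 285360818554
   / 11232619483209 * C ^ 3 + 1112159159480 / 11232619483209 * A ^ 2 * C ^ 3 - 922057412009 /
   3744206494403 * A * C ^ 2 - 1851271657830 / 3744206494403 * A ^ 3 * C ^ 2 + 1852040350658 /
   3744206494403 * C + 336400591390 / 3744206494403 * A ^ 2 * C + 474569367729334 /
   7020387177005625 * A - 3364214326665064 / 49142710239039375 * A ^ 3, -4379166515483 /
   22465238966418 * A * C ^ 3 - 5662710375455 / 11232619483209 * A ^ 3 * C ^ 3 + 80519581864887 /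
   14976825977612 * C ^ 2 + 24956383211645 / 7488412988806 * A ^ 2 * C ^ 2 - 9049492109168 /
   3744206494403 * A * C - 16404121575295 / 26209445460821 * A ^ 3 * C + 3126929642800397 /
   4680258118003750 - 770672327400056 / 16380903413013125 * A ^ 2, 21409639603803 / 7488412988806 *
   C ^ 3 + 7039974461055 / 3744206494403 * A ^ 2 * C ^ 3 - 1051111212114955 / 67395716899254 * A *
   C ^ 2 - 2686716641085325 / 235885009147389 * A ^ 3 * C ^ 2 + 22733451027597 / 3744206494403 * C
   + 30534117623255 / 3744206494403 * A ^ 2 * C - 5910508116210709 / 4212232306203375 * A -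
   8087985427429811 / 29485626143423625 * A ^ 3, -16374457378621 / 3744206494403 * A * C ^ 3 -
   14724710085170 / 3744206494403 * A ^ 3 * C ^ 3 + 1189088641654075 / 22465238966418 * C ^ 2 +
   517248344841175 / 11232619483209 * A ^ 2 * C ^ 2 - 64296970996520 / 3744206494403 * A * C -
   387331883579850 / 26209445460821 * A ^ 3 * C + 3309511839731879 / 936051623600750 +
   1082122224112419 / 468025811800375 * A ^ 2, 36780303688697 / 3744206494403 * C ^ 3 +
   27304672295962 / 3744206494403 * A ^ 2 * C ^ 3 - 841699441526195 / 11232619483209 * A * C ^ 2 -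
   4793792726687206 / 78628336382463 * A ^ 3 * C ^ 2 + 760765659524503 / 18721032472015 * C +
   773697846411346 / 18721032472015 * A ^ 2 * C - 74647849437913 / 11232619483209 * A -
   229116710548724 / 78628336382463 * A ^ 3, -176815640039750 / 33697858449627 * A * C ^ 3 -
   145932291266536 / 33697858449627 * A ^ 3 * C ^ 3 + 2197936374629036 / 18721032472015 * C ^ 2 +
   5851506332577446 / 56163097416045 * A ^ 2 * C ^ 2 - 7045638128705189 / 168489292248135 * A * C -
   45182739411880186 / 1179425045736945 * A ^ 3 * C + 5321430110916397 / 561630974160450 +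
   2081513872704992 / 280815487080225 * A ^ 2, 8065479797260 / 3744206494403 * C ^ 3 +
   3123610888832 / 3744206494403 * A ^ 2 * C ^ 3 - 261533881983690 / 3744206494403 * A * C ^ 2 -
   1507523480325112 / 26209445460821 * A ^ 3 * C ^ 2 + 2566288962968099 / 56163097416045 * C +
   2502261028172728 / 56163097416045 * A ^ 2 * C - 453959675590583 / 56163097416045 * A -
   1545319455989422 / 393141681912315 * A ^ 3, 9546511573600 / 11232619483209 * A * C ^ 3 +
   6843662212520 / 11232619483209 * A ^ 3 * C ^ 3 + 153625313693468 / 3744206494403 * C ^ 2 +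
   133007350045456 / 3744206494403 * A ^ 2 * C ^ 2 - 64809576027804 / 3744206494403 * A * C -
   404861160370172 / 26209445460821 * A ^ 3 * C + 108055938712371 / 18721032472015 + 48172783209092
   / 18721032472015 * A ^ 2, -9546511573600 / 33697858449627 * C ^ 3 - 6843662212520 /
   33697858449627 * A ^ 2 * C ^ 3 - 72733590008416 / 11232619483209 * A * C ^ 2 - 410466570715400 /
   78628336382463 * A ^ 3 * C ^ 2 + 52179915919622 / 11232619483209 * C + 54960608748316 /
   11232619483209 * A ^ 2 * C - 33088997882132 / 101093575348881 * A - 526043042767996 /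
   707655027442167 * A ^ 3]

/-- The numerator of order 7 of `resonantSeries`. -/
noncomputable def resonantNumSeven (A C : ℝ) : List ℝ :=
  [56272152689069 / 281844134822250 * A * C ^ 2 - 22102558253561 / 140922067411125 * A ^ 3 * C ^ 2
   + 288910069985861 / 3523051685278125 * C - 8106499092437 / 391450187253125 * A ^ 2 * C +
   14970269240909 / 1509879293690625 * A - 5063335893877 / 1509879293690625 * A ^ 3, 100498958413 /
   235458759250 * C ^ 2 + 16662517981 / 824105657375 * A ^ 2 * C ^ 2 + 560437010396 / 1765940694375
   * A * C - 4684336958398 / 37084754581875 * A ^ 3 * C + 27102863106181 / 185423772909375 -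
   82232321829929 / 556271318728125 * A ^ 2, -39334192621 / 87258246075 * A * C ^ 2 - 139718514904
   / 87258246075 * A ^ 3 * C ^ 2 + 4882064639299 / 2181456151875 * C - 3175978034947 /
   2181456151875 * A ^ 2 * C - 4644721163633 / 6544368455625 * A + 1704141546808 / 2181456151875 *
   A ^ 3, 126098059 / 10073102 * C ^ 2 + 5748658079 / 1163443281 * A ^ 2 * C ^ 2 - 89608093216 /
   17451649215 * A * C + 5895503818 / 1586513565 * A ^ 3 * C - 1821329566072 / 436291230375 -
   408047259377 / 1308873691125 * A ^ 2, -306095290 / 12785091 * A * C ^ 2 - 86720228 / 5811405 * A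
   ^ 3 * C ^ 2 - 2360724617 / 447478185 * C + 174561274 / 1342434555 * A ^ 2 * C + 2137490849 /
   435855375 * A + 315271825018 / 100682591625 * A ^ 3, 367730647 / 5811405 * C ^ 2 + 1982368222 /
   40679835 * A ^ 2 * C ^ 2 - 67367360 / 8135967 * A * C + 314437792 / 52302645 * A ^ 3 * C -
   15634450708 / 1016995875 - 69388669534 / 9152962875 * A ^ 2, -1008165292 / 13559945 * A * C ^ 2
   - 20275568 / 387427 * A ^ 3 * C ^ 2 - 77409258 / 13559945 * C + 126220876 / 13559945 * A ^ 2 * C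
   + 2873188168 / 203399175 * A + 1585206556 / 203399175 * A ^ 3, 176377512 / 1937135 * C ^ 2 +
   29234248 / 387427 * A ^ 2 * C ^ 2 - 32190562 / 1937135 * A * C - 1626096 / 387427 * A ^ 3 * C -
   145150751 / 9685675 - 249801626 / 29057025 * A ^ 2, -51015404 / 1162281 * A * C ^ 2 - 35182720 /
   1162281 * A ^ 3 * C ^ 2 + 8661184 / 1162281 * C + 16829764 / 1162281 * A ^ 2 * C + 2034190 /
   387427 * A + 868352 / 387427 * A ^ 3, 6308864 / 387427 * C ^ 2 + 3979000 / 387427 * A ^ 2 * C ^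
   2 - 2613676 / 387427 * A * C - 4167280 / 2711989 * A ^ 3 * C - 2118310 / 1162281 + 70204 /
   1162281 * A ^ 2]

/-- The formal first integral at the roots of the third-order obstruction. -/
noncomputable def resonantSeries (A C : ℝ) (hA : A ^ 2 < 2) : ℕ → PlaneFun
    | 3 => PlaneFun.firstIntegral A hA
    | 4 => PlaneFun.overQuartic A hA 0 [] 0
    | 5 =>
      let κ := 31 / 111 * A * C + 20 / 111 * A ^ 3 * C + 3 / 74 - 5 / 37 * A ^ 2
      PlaneFun.overQuartic A hA 6
        [κ, -4 * A * κ, (3 + 4 * A ^ 2) * κ, (A - C - 16 * A * κ) / 3] 1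
    | 6 => PlaneFun.overQuartic A hA 7
        [A / 15 - 2 * A ^ 3 / 35, (3 - 2 * A ^ 2 / 3) / 5, -2 * A / 3, 1] 1
    | 7 => PlaneFun.overQuartic A hA 12 (resonantNumFour A C) 2
    | 8 => PlaneFun.overQuartic A hA 13 (resonantNumFive A C) 2
    | 9 => PlaneFun.overQuartic A hA 18 (resonantNumSix A C) 3
    | 10 => PlaneFun.overQuartic A hA 19 (resonantNumSeven A C) 3
    | _ => PlaneFun.poly 0 []

theorem lieCoeff_resonantSeries_four {A : ℝ} (hA : A ^ 2 < 2)
    (hr : 10 * A ^ 4 - 7 * A ^ 2 - 21 = 0) (C : ℝ) {X Y : ℝ} (hne : (X, Y) ≠ 0) :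
    lieCoeff (A, 0, C) (resonantSeries A C hA) 4 X Y = 0 := by
  rw [lieCoeff_overQuartic hA C (h := resonantSeries A C hA) (i := 4) (m₂ := 1) (m₃ := 0) 
    (e₂ := 0) (e₃ := 1) (m := 2) rfl rfl rfl rfl rfl hne, div_eq_zero_iff]
  left
  simp only [resonantNumFour, polyVal, polyDx, polyDy, quartic, Nat.reduceSub]
  push_cast
  linear_combination (-41448 / 2711989 * X ^ 13 * C - 151594 / 387427 * X ^ 11 * Y * C ^ 2 + 48330
    / 387427 * X ^ 11 * Y + 958172 / 8135967 * X ^ 9 * Y ^ 2 * C - 610810 / 387427 * X ^ 7 * Y ^ 3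
    * C ^ 2 + 16 / 111 * X ^ 7 * Y ^ 3 * A * C + 490808 / 5811405 * X ^ 7 * Y ^ 3 + 16 / 111 * X ^
    5 * Y ^ 4 * A * C ^ 2 - 76 / 111 * X ^ 5 * Y ^ 4 * C - 16 / 111 * X ^ 5 * Y ^ 4 * A ^ 2 * C + 4
    / 37 * X ^ 5 * Y ^ 4 * A + 5926604 / 3486843 * X ^ 3 * Y ^ 5 * C ^ 2 + 128 / 333 * X ^ 3 * Y ^
    5 * A * C - 2477938 / 5811405 * X ^ 3 * Y ^ 5 - 32 / 333 * X * Y ^ 6 * A * C ^ 2 + 7855184 /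
    24407901 * X * Y ^ 6 * C) * hr

theorem lieCoeff_resonantSeries_five {A : ℝ} (hA : A ^ 2 < 2)
    (hr : 10 * A ^ 4 - 7 * A ^ 2 - 21 = 0) (C : ℝ) {X Y : ℝ} (hne : (X, Y) ≠ 0) :
    lieCoeff (A, 0, C) (resonantSeries A C hA) 5 X Y =
      (2253 / 5005 * A * C - 8027 / 15015 * A ^ 3 * C + 584609 / 2252250 + 5647 / 87750 * A ^ 2)
        * (X ^ (2 * 7) * (1 / quartic A X Y ^ 2)) := by
  rw [lieCoeff_overQuartic hA C (h := resonantSeries A C hA) (i := 5) (m₂ := 1) (m₃ := 1) 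
    (e₂ := 0) (e₃ := 0) (m := 2) rfl rfl rfl rfl rfl hne, mul_one_div, ← mul_div_assoc]
  congr 1
  simp only [resonantNumFive, polyVal, polyDx, polyDy, quartic, Nat.reduceSub]
  push_cast
  linear_combination (12367 / 9259250 * X ^ 14 + 1457 / 30525 * X ^ 12 * Y * C + 76154 / 174825 * X
    ^ 10 * Y ^ 2 + 25562 / 19425 * X ^ 8 * Y ^ 3 * C + 16 / 111 * X ^ 6 * Y ^ 4 * A * C + 424 /
    2775 * X ^ 6 * Y ^ 4 - 48 / 37 * X ^ 4 * Y ^ 5 * C - 16 / 111 * X ^ 4 * Y ^ 5 * A ^ 2 * C + 4 /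
    37 * X ^ 4 * Y ^ 5 * A + 128 / 333 * X ^ 2 * Y ^ 6 * A * C - 80 / 111 * X ^ 2 * Y ^ 6 - 64 /
    333 * Y ^ 7 * C) * hr

theorem lieCoeff_resonantSeries_six {A : ℝ} (hA : A ^ 2 < 2)
    (hr : 10 * A ^ 4 - 7 * A ^ 2 - 21 = 0) (C : ℝ) {X Y : ℝ} (hne : (X, Y) ≠ 0) :
    lieCoeff (A, 0, C) (resonantSeries A C hA) 6 X Y = 0 := by
  rw [lieCoeff_overQuartic hA C (h := resonantSeries A C hA) (i := 6) (m₂ := 2) (m₃ := 1) 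
    (e₂ := 0) (e₃ := 1) (m := 3) rfl rfl rfl rfl rfl hne, div_eq_zero_iff]
  left
  simp only [resonantNumFour, resonantNumSix, polyVal, polyDx, polyDy, quartic, Nat.reduceSub]
  push_cast
  linear_combination (-40765831222 / 33697858449627 * X ^ 19 * C ^ 3 - 1852040350658 /
    78628336382463 * X ^ 19 * C - 1851271657830 / 3744206494403 * X ^ 17 * Y * C ^ 2 -
    3364214326665064 / 49142710239039375 * X ^ 17 * Y - 4530168300364 / 11232619483209 * X ^ 15 * Y
    ^ 2 * C ^ 3 - 13323579985472 / 26209445460821 * X ^ 15 * Y ^ 2 * C - 545195273100895 /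
    78628336382463 * X ^ 13 * Y ^ 3 * C ^ 2 - 6606162894346511 / 49142710239039375 * X ^ 13 * Y ^ 3
    - 2959787580736 / 3744206494403 * X ^ 11 * Y ^ 4 * C ^ 3 - 161471804655120 / 26209445460821 * X
    ^ 11 * Y ^ 4 * C + 4 / 175 * X ^ 11 * Y ^ 4 * A - 4351577186554796 / 393141681912315 * X ^ 9 *
    Y ^ 5 * C ^ 2 - 552966622078316 / 655236136520525 * X ^ 9 * Y ^ 5 + 3329788 / 1162281 * X ^ 7 *
    Y ^ 6 * C ^ 3 - 1800888 / 13559945 * X ^ 7 * Y ^ 6 * C + 2251307070200452 / 131047227304105 * X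
    ^ 5 * Y ^ 7 * C ^ 2 + 730903153600012 / 1965708409561575 * X ^ 5 * Y ^ 7 - 45239384306456 /
    11232619483209 * X ^ 3 * Y ^ 8 * C ^ 3 + 577050696479588 / 78628336382463 * X ^ 3 * Y ^ 8 * C +
    176780406457576 / 78628336382463 * X * Y ^ 9 * C ^ 2 + 526043042767996 / 1179425045736945 * X *
    Y ^ 9) * hr

theorem lieCoeff_resonantSeries_seven {A : ℝ} (hA : A ^ 2 < 2)
    (hr : 10 * A ^ 4 - 7 * A ^ 2 - 21 = 0) (C : ℝ) {X Y : ℝ} (hne : (X, Y) ≠ 0) :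
    lieCoeff (A, 0, C) (resonantSeries A C hA) 7 X Y =
      (-12352738714 / 3204361875 * C ^ 2 + 79975648432 / 67291599375 * A ^ 2 * C ^ 2 + 465466788803
       / 336457996875 * A * C - 133079209709 / 336457996875 * A ^ 3 * C + 20418287819 /
       373842218750 - 499144408639 / 10093739906250 * A ^ 2)
        * (X ^ (2 * 10) * (1 / quartic A X Y ^ 3)) := by
  rw [lieCoeff_overQuartic hA C (h := resonantSeries A C hA) (i := 7) (m₂ := 2) (m₃ := 2) 
    (e₂ := 0) (e₃ := 0) (m := 3) rfl rfl rfl rfl rfl hne, mul_one_div, ← mul_div_assoc]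
  congr 1
  simp only [resonantNumFour, resonantNumFive, resonantNumSeven, polyVal, polyDx, polyDy,
      quartic, Nat.reduceSub]
  push_cast
  linear_combination (-22102558253561 / 108401590316250 * X ^ 20 * C ^ 2 - 5063335893877 /
    1161445610531250 * X ^ 20 - 2342168479199 / 16856706628125 * X ^ 18 * Y * C - 69859257452 /
    48476803375 * X ^ 16 * Y ^ 2 * C ^ 2 + 7675111703486 / 10907280759375 * X ^ 16 * Y ^ 2 +
    1136334994082 / 436291230375 * X ^ 14 * Y ^ 3 * C - 2457007114 / 319627275 * X ^ 12 * Y ^ 4 * C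
    ^ 2 + 161822498759 / 100682591625 * X ^ 12 * Y ^ 4 + 2421088 / 52302645 * X ^ 10 * Y ^ 5 * C -
    1299844054 / 203399175 * X ^ 8 * Y ^ 6 * C ^ 2 - 464574182 / 1016995875 * X ^ 8 * Y ^ 6 -
    283002192 / 67799725 * X ^ 6 * Y ^ 7 * C + 18826924 / 1162281 * X ^ 4 * Y ^ 8 * C ^ 2 -
    13016758 / 5811405 * X ^ 4 * Y ^ 8 + 2925544 / 1162281 * X ^ 2 * Y ^ 9 * C) * hr

theorem obstruction_seven_ne_zero {A C : ℝ} (hr : 10 * A ^ 4 - 7 * A ^ 2 - 21 = 0)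
    (h5 : 2253 / 5005 * A * C - 8027 / 15015 * A ^ 3 * C +
        584609 / 2252250 + 5647 / 87750 * A ^ 2 = 0) :
    -12352738714 / 3204361875 * C ^ 2 + 79975648432 / 67291599375 * A ^ 2 * C ^ 2 + 465466788803 /
      336457996875 * A * C - 133079209709 / 336457996875 * A ^ 3 * C + 20418287819 / 373842218750 -
      499144408639 / 10093739906250 * A ^ 2 ≠ 0 := by
  intro h7
  have hC : C = 225 / 929 * A + 4528 / 58527 * A ^ 3 := by
    linear_combination (-229638409 / 255205590 * A - 1630343 / 25520559 * A ^ 3) * h5 - (1 / 21 * C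
      + 91515827 / 26796586950 * A ^ 2 * C - 708195917 / 1722637732500 * A) * hr
  rw [hC] at h7
  have h2 : -3680967069436901 / 68797650440390625 +
      233854041404795993 / 15892257251730234375 * A ^ 2 = 0 := by
    linear_combination h7 - (-42384661099832520383 / 8232189256396261406250 - 342093879844480184 /
      823218925639626140625 * A ^ 2 + 819861722530617344 / 1152506495895476596875 * A ^ 4) * hr
  have h3 : A ^ 2 = 850303393039924131/233854041404795993 := by linarith
  rw [show A ^ 4 = (A ^ 2) ^ 2 by ring, h3] at hr
  norm_num at hr

theorem resonantSeries_zero_left {A : ℝ} (hA : A ^ 2 < 2) (C : ℝ)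
    {k : ℕ} (hk : k ≤ 7) (hodd : Odd k)
    (y : ℝ) : (resonantSeries A C hA (k + 3)).toFun 0 y = 0 := by
  interval_cases k
  all_goals first
    | exact absurd hodd (by decide)
    | simp [resonantSeries, PlaneFun.overQuartic, polyVal, resonantNumFive, resonantNumSeven]

theorem hasReturnGap_of_eq_zero_of_eq {A C : ℝ} (hA : A ^ 2 < 2)
    (hr : 10 * A ^ 4 - 7 * A ^ 2 - 21 = 0) : HasReturnGap (A, 0, C) := by
  have h0 : ∀ i < 3, resonantSeries A C hA i = PlaneFun.poly 0 [] :=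
    fun i hi => by interval_cases i <;> rfl
  have hlow : ∀ i < 5, ∀ X Y, (X, Y) ≠ 0 →
      lieCoeff (A, 0, C) (resonantSeries A C hA) i X Y = 0 := by
    intro i hi X Y hne
    rcases lt_or_ge i 3 with hi3 | hi3
    · refine lieCoeff_of_lt_three hA ?_ h0 rfl rfl rfl hi3 hne
      linear_combination (4 / 37 - 16 / 111 * A * C) * hr
    interval_cases i
    · rw [lieCoeff_three hA C rfl rfl rfl hne, hr]
      simp
    · exact lieCoeff_resonantSeries_four hA hr C hne
  by_cases h5 : 2253 / 5005 * A * C - 8027 / 15015 * A ^ 3 * C +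
      584609 / 2252250 + 5647 / 87750 * A ^ 2 = 0
  · refine hasReturnGap_of_series hA (n := 7) (by decide) le_rfl _ h0
      (fun k hk hodd y => resonantSeries_zero_left hA C hk hodd y)
          (obstruction_seven_ne_zero hr h5) 10
      (G := fun X Y => 1 / quartic A X Y ^ 3) (continuousOn_div_quartic_pow hA continuous_const 3)
      (fun X Y h => by have := quartic_pos hA h; positivity) (fun i hi X Y hne => ?_)
      (fun X Y hne => lieCoeff_resonantSeries_seven hA hr C hne)
    rcases lt_or_ge i 5 with hi5 | hi5
    · exact hlow i hi5 X Y hne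
    interval_cases i
    · rw [lieCoeff_resonantSeries_five hA hr C hne, h5, zero_mul]
    · exact lieCoeff_resonantSeries_six hA hr C hne
  · exact hasReturnGap_of_series hA (n := 5) (by decide) (by norm_num) _ h0
      (fun k hk hodd y => resonantSeries_zero_left hA C (by omega) hodd y) h5 7
      (G := fun X Y => 1 / quartic A X Y ^ 2) (continuousOn_div_quartic_pow hA continuous_const 2)
      (fun X Y h => by have := quartic_pos hA h; positivity) hlow
      (fun X Y hne => lieCoeff_resonantSeries_five hA hr C hne)

theorem hasReturnGap {p : ℝ × ℝ × ℝ} (hp : p.1 ^ 2 < 2) : HasReturnGap p := by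
  obtain ⟨A, B, C⟩ := p
  rcases eq_or_ne A 0 with rfl | hA
  · exact hasReturnGap_of_eq_zero B C
  rcases eq_or_ne B 0 with rfl | hB
  · by_cases hr : 10 * A ^ 4 - 7 * A ^ 2 - 21 = 0
    · exact hasReturnGap_of_eq_zero_of_eq hp hr
    · exact hasReturnGap_of_eq_zero_of_ne hp hr
  · exact hasReturnGap_of_ne_zero hp hA hB

theorem finite_and_ncard_le {α : Type*} {s : Set α} {n : ℕ}
    (h : ∀ F : Finset α, (F : Set α) ⊆ s → F.card ≤ n) : s.Finite ∧ s.ncard ≤ n := by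
  have hfin : s.Finite := by
    by_contra hinf
    obtain ⟨F, hF, hc⟩ := Set.Infinite.exists_subset_card_eq hinf (n + 1)
    have := h F hF
    omega
  refine ⟨hfin, ?_⟩
  rw [Set.ncard_eq_toFinset_card s hfin]
  exact h _ (by simp)

theorem polarM_neg (p : ℝ × ℝ × ℝ) (r θ : ℝ) : polarM p (-r) (-θ) = -polarM p r θ := by
  have h1 : polarNum p (-r) (-Real.sin θ) (Real.cos θ) =
      -polarNum p r (Real.sin θ) (Real.cos θ) := by
    simp only [polarNum, polarP, polarQ]; ring
  have h2 : polarDelta p (-r) (-Real.sin θ) (Real.cos θ)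
      = polarDelta p r (Real.sin θ) (Real.cos θ) := by
    simp only [polarDelta, polarP, polarQ]; ring
  rw [polarM, polarM, Real.sin_neg, Real.cos_neg, h1, h2]
  ring

/-- Cyclicity bound near a parameter with a return gap. -/
theorem HasReturnGap.exists_card_le {p₀ : ℝ × ℝ × ℝ} (hp : p₀.1 ^ 2 < 2) (hgap : HasReturnGap p₀) :
    ∃ V ∈ 𝓝 (0 : ℝ × ℝ), ∀ᶠ p in 𝓝 p₀, ∀ F : Finset (Set (ℝ × ℝ)),
      (∀ Γ ∈ F, IsPeriodicOrbit42 p.1 p.2.1 p.2.2 Γ ∧ Γ ⊆ V) → F.card ≤ 3 := by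
  obtain ⟨φ, η₁, hη₁, hφ, huniq, hex⟩ := exists_polar_half_map hp
  obtain ⟨m, hm, η₂, hη₂, hΔ⟩ := exists_polarDelta_ge hp
  set d : ℝ × (ℝ × ℝ × ℝ) → ℝ := fun q => φ q + φ (-q.1, q.2) with hd
  have hdc : ContDiffAt ℝ (8 + 1 : ℕ) d (0, p₀) := by
    refine hφ.add (ContDiffAt.comp (g := φ) (0, p₀) (by simpa using hφ) (by fun_prop))
  have hdO : ¬ ((fun ρ => d (ρ, p₀)) =O[𝓝 0] fun ρ : ℝ => ρ ^ (8 + 1)) := by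
    intro hO
    obtain ⟨η, hη, c, hc, hgap⟩ := hgap
    obtain ⟨K, hK⟩ := hO.bound
    have hex1 := hex η hη
    have hex2 : ∀ᶠ ρ in 𝓝 (0 : ℝ), ∃ R : ℝ → ℝ, R 0 = -ρ ∧ φ (-ρ, p₀) = R Real.pi ∧
        IsHalfTurn p₀ η R := by
      have : Tendsto (fun ρ : ℝ => -ρ) (𝓝 0) (𝓝 0) := by
          simpa using (continuous_neg.tendsto (0 : ℝ))
      exact this.eventually hex1
    have hsmall : ∀ᶠ ρ in 𝓝 (0 : ℝ), K * ρ < c := by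
      have : Tendsto (fun ρ : ℝ => K * ρ) (𝓝 0) (𝓝 0) :=
        (by fun_prop : Continuous fun ρ : ℝ => K * ρ).tendsto' 0 0 (by simp)
      exact this.eventually_lt_const hc
    have hall := ((hK.and (hex1.and (hex2.and hsmall))).filter_mono
      (nhdsWithin_le_nhds (s := Ioi 0))).and (hgap.and self_mem_nhdsWithin)
    obtain ⟨ρ, ⟨h1, ⟨R₁, h2, h3, h4⟩, ⟨R₂, h5, h6, h7⟩, h8⟩, h9, h10⟩ := hall.exists
    have h11 := h9 R₁ R₂ h2 h5 h4 h7
    have h10 : 0 < ρ := h10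
    simp only [hd, h3, h6, Real.norm_eq_abs] at h1
    rw [abs_of_pos (by positivity : (0 : ℝ) < ρ ^ (8 + 1))] at h1
    have h12 : 0 < ρ ^ 8 := by positivity
    have : c ≤ K * ρ := le_of_mul_le_mul_right (by
      calc c * ρ ^ 8 ≤ _ := h11
        _ ≤ _ := h1
        _ = K * ρ * ρ ^ 8 := by ring) h12
    linarith
  obtain ⟨δ, hδ, hcount⟩ := exists_card_zeros_le p₀ 8 d hdc hdO
  set η := min η₂ (min η₁ δ) with hη
  have hηpos : 0 < η := by positivity
  have hηη₁ : η ≤ η₁ := (min_le_right _ _).trans (min_le_left _ _)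
  have hηδ : η ≤ δ := (min_le_right _ _).trans (min_le_right _ _)
  refine ⟨{z | quasiRadius z < η}, (continuous_quasiRadius.isOpen_preimage _ isOpen_Iio).mem_nhds
    (by simpa [quasiRadius] using hηpos), ?_⟩
  filter_upwards [huniq, hΔ, hcount] with p hu hΔp hcp F hF
  have key : ∀ Γ ∈ F, ∃ ρ > 0, ρ < δ ∧ d (ρ, p) = 0 ∧ ((0 : ℝ), ρ ^ 2) ∈ Γ := by
    intro Γ hΓ
    obtain ⟨⟨γ, T, hT, hγ, hper, hne, rfl⟩, hsub⟩ := hF Γ hΓ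
    obtain ⟨R, hR, hRb, hRper, t, ht⟩ := hγ.exists_polar hm
      (fun r hr => hΔp r (hr.trans_le (min_le_left _ _))) hT hper hne fun t => hsub ⟨t, rfl⟩
    refine ⟨R 0, (hRb 0).1, (hRb 0).2.trans_le hηδ, ?_, t, ht⟩
    have e1 : φ (R 0, p) = R Real.pi := hu R fun t _ =>
      ⟨hR t, by rw [abs_of_pos (hRb t).1]; exact (hRb t).2.trans_le hηη₁⟩
    have e2 : φ (-R 0, p) = -R Real.pi := by
      have := hu (fun θ => -R (-θ)) fun t _ => ⟨?_, ?_⟩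
      · rw [neg_zero] at this
        rw [this, ← hRper (-Real.pi)]
        congr 2; ring
      · have h1 := ((hR (-t)).scomp t (hasDerivAt_neg t)).neg
        convert! h1 using 1
        have := polarM_neg p (R (-t)) (-t)
        rw [neg_neg] at this
        rw [this]; simp
      · rw [abs_neg, abs_of_pos (hRb _).1]; exact (hRb _).2.trans_le hηη₁
    simp only [hd, e1, e2, add_neg_cancel]
  choose! f hfpos hfδ hfd hfm using key
  have hinj : ∀ Γ₁ ∈ F, ∀ Γ₂ ∈ F, f Γ₁ = f Γ₂ → Γ₁ = Γ₂ := by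
    intro Γ₁ h₁ Γ₂ h₂ heq
    have m₁ := hfm _ h₁
    have m₂ := hfm _ h₂
    rw [heq] at m₁
    obtain ⟨⟨γ₁, T₁, hT₁, hγ₁, hper₁, -, rfl⟩, -⟩ := hF _ h₁
    obtain ⟨⟨γ₂, T₂, hT₂, hγ₂, hper₂, -, rfl⟩, -⟩ := hF _ h₂
    obtain ⟨t₁, ht₁⟩ := m₁
    obtain ⟨t₂, ht₂⟩ := m₂
    exact hγ₁.range_eq_of_eq hγ₂ (hper₁.isBounded_of_continuous hT₁.ne' hγ₁.continuous)
      (hper₂.isBounded_of_continuous hT₂.ne' hγ₂.continuous) (ht₁.trans ht₂.symm)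
  have hd0 : d (0, p) = 0 := by
    have := hu (fun _ => 0) fun t _ =>
        ⟨by simpa using hasDerivAt_const t (0 : ℝ), by simpa using hη₁⟩
    simp [hd, this]
  have hdneg : ∀ ρ, d (-ρ, p) = d (ρ, p) := fun ρ => by simp only [hd, neg_neg]; ring
  set Z₁ := F.image f
  set Z₂ := Z₁.image Neg.neg
  have c₁ : Z₁.card = F.card := Finset.card_image_of_injOn fun a ha b hb => hinj a ha b hb
  have c₂ : Z₂.card = F.card := by rw [← c₁]; exact Finset.card_image_of_injective _ neg_injective
  have p₁ : ∀ z ∈ Z₁, 0 < z ∧ z < δ ∧ d (z, p) = 0 := fun z hz => by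
    obtain ⟨Γ, hΓ, rfl⟩ := Finset.mem_image.1 hz
    exact ⟨hfpos _ hΓ, hfδ _ hΓ, hfd _ hΓ⟩
  have p₂ : ∀ z ∈ Z₂, z < 0 ∧ -δ < z ∧ d (z, p) = 0 := fun z hz => by
    obtain ⟨w, hw, rfl⟩ := Finset.mem_image.1 hz
    obtain ⟨h1, h2, h3⟩ := p₁ w hw
    exact ⟨by linarith, by linarith, by rw [hdneg, h3]⟩
  have hdisj : Disjoint Z₁ Z₂ := Finset.disjoint_left.2 fun z h1 h2 =>
    lt_asymm (p₁ z h1).1 (p₂ z h2).1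
  have h0 : (0 : ℝ) ∉ Z₁ ∪ Z₂ := fun h => by
    rcases Finset.mem_union.1 h with h | h
    · exact lt_irrefl _ (p₁ _ h).1
    · exact lt_irrefl _ (p₂ _ h).1
  have := hcp (insert 0 (Z₁ ∪ Z₂)) fun z hz => by
    rcases Finset.mem_insert.1 hz with rfl | hz
    · exact ⟨⟨by linarith, hδ⟩, hd0⟩
    rcases Finset.mem_union.1 hz with hz | hz
    · obtain ⟨h1, h2, h3⟩ := p₁ z hz
      exact ⟨⟨by linarith, h2⟩, h3⟩
    · obtain ⟨h1, h2, h3⟩ := p₂ z hz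
      exact ⟨⟨h2, by linarith⟩, h3⟩
  rw [Finset.card_insert_of_notMem h0, Finset.card_union_of_disjoint hdisj, c₁, c₂] at this
  omega

/-- **Proposition 4.2.**  On a compact set of parameters `(A,B,C)` with `A² < 2`,
system (4.2) has at most `3` limit cycles in some fixed neighborhood `V` of the origin. -/
theorem system42_at_most_three_limit_cycles
    (D : Set (ℝ × ℝ × ℝ)) (hD : IsCompact D)
    (hcond : ∀ A B C : ℝ, (A, B, C) ∈ D → A ^ 2 < 2) :
    ∃ V ∈ nhds (0 : ℝ × ℝ), ∀ A B C : ℝ, (A, B, C) ∈ D →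
      {Γ : Set (ℝ × ℝ) | IsLimitCycle42 A B C Γ ∧ Γ ⊆ V}.Finite ∧
      {Γ : Set (ℝ × ℝ) | IsLimitCycle42 A B C Γ ∧ Γ ⊆ V}.ncard ≤ 3 := by
  have key : ∃ V ∈ 𝓝 (0 : ℝ × ℝ), ∀ p ∈ D, ∀ F : Finset (Set (ℝ × ℝ)),
      (∀ Γ ∈ F, IsPeriodicOrbit42 p.1 p.2.1 p.2.2 Γ ∧ Γ ⊆ V) → F.card ≤ 3 := by
    refine hD.induction_on (p := fun s => ∃ V ∈ 𝓝 (0 : ℝ × ℝ), ∀ p ∈ s, ∀ F : Finset (Set (ℝ × ℝ)),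
      (∀ Γ ∈ F, IsPeriodicOrbit42 p.1 p.2.1 p.2.2 Γ ∧ Γ ⊆ V) → F.card ≤ 3)
      ⟨univ, univ_mem, by simp⟩ ?_ ?_ ?_
    · rintro s t hst ⟨V, hV, h⟩
      exact ⟨V, hV, fun p hp => h p (hst hp)⟩
    · rintro s t ⟨V, hV, hs⟩ ⟨W, hW, ht⟩
      refine ⟨V ∩ W, inter_mem hV hW, fun p hp F hF => ?_⟩
      rcases hp with hp | hp
      · exact hs p hp F fun Γ hΓ => ⟨(hF Γ hΓ).1, (hF Γ hΓ).2.trans inter_subset_left⟩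
      · exact ht p hp F fun Γ hΓ => ⟨(hF Γ hΓ).1, (hF Γ hΓ).2.trans inter_subset_right⟩
    · intro p hp
      have hp2 : p.1 ^ 2 < 2 := hcond p.1 p.2.1 p.2.2 hp
      obtain ⟨V, hV, h⟩ := (hasReturnGap hp2).exists_card_le hp2
      exact ⟨_, mem_nhdsWithin_of_mem_nhds h, V, hV, fun p hp => hp⟩
  obtain ⟨V, hV, h⟩ := key
  refine ⟨V, hV, fun A B C hABC =>
      finite_and_ncard_le fun F hF => h (A, B, C) hABC F fun Γ hΓ => ?_⟩
  have := hF hΓ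
  exact ⟨this.1.1, this.2⟩
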